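/- arXiv:1208.2433 — 10 statements merged into one kernel-verified Lean document; each statement's English description precedes it below -/
import Mathlib

section
/- Let C be a category with duality over a field k (with finite-dimensional Hom-spaces) and let X₁, X₂ be objects of C whose biproduct X₁ ⊕ X₂ exists in C. Then ν(X₁ ⊕ X₂) = ν(X₁) + ν(X₂). -/
open CategoryTheory

universe v u

/-- A category with duality: a contravariant endofunctor `(dObj, dMap)` together with a
pivotal morphism `j : id → (−)^∨∨` satisfying `(j_X)^∨ ∘ j_{X^∨} = id`. -/
structure DualityStruct (C : Type u) [Category.{v} C] where
  dObj : C → C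
  dMap : ∀ {X Y : C}, (X ⟶ Y) → (dObj Y ⟶ dObj X)
  dMap_id : ∀ X : C, dMap (𝟙 X) = 𝟙 (dObj X)
  dMap_comp : ∀ {X Y Z : C} (f : X ⟶ Y) (g : Y ⟶ Z), dMap (f ≫ g) = dMap g ≫ dMap f
  j : ∀ X : C, X ⟶ dObj (dObj X)
  j_natural : ∀ {X Y : C} (f : X ⟶ Y), f ≫ j Y = j X ≫ dMap (dMap f)
  coherence : ∀ X : C, j (dObj X) ≫ dMap (j X) = 𝟙 (dObj X)

/-- A category with duality over a field `k`: the ambient category is `k`-linear and the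
duality functor is `k`-linear. -/
structure LinearDualityStruct (k : Type*) [Field k] (C : Type u) [Category.{v} C]
    [Preadditive C] [CategoryTheory.Linear k C] extends DualityStruct C where
  dMap_add : ∀ {X Y : C} (f g : X ⟶ Y), dMap (f + g) = dMap f + dMap g
  dMap_smul : ∀ {X Y : C} (c : k) (f : X ⟶ Y), dMap (c • f) = c • dMap f

variable (k : Type*) [Field k] {C : Type u} [Category.{v} C]
  [Preadditive C] [CategoryTheory.Linear k C]

/-- The transposition map `T_{X,Y} : Hom(X, Y^∨) → Hom(Y, X^∨)`, `f ↦ f^∨ ∘ j_Y`,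
as a `k`-linear map. -/
def LinearDualityStruct.transHom (dd : LinearDualityStruct k C) (X Y : C) :
    (X ⟶ dd.dObj Y) →ₗ[k] (Y ⟶ dd.dObj X) where
  toFun f := dd.j Y ≫ dd.dMap f
  map_add' f g := by
    show dd.j Y ≫ dd.dMap (f + g) = dd.j Y ≫ dd.dMap f + dd.j Y ≫ dd.dMap g
    rw [dd.dMap_add, Preadditive.comp_add]
  map_smul' c f := by
    show dd.j Y ≫ dd.dMap (c • f) = c • (dd.j Y ≫ dd.dMap f)
    rw [dd.dMap_smul, CategoryTheory.Linear.comp_smul]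

/-- The Frobenius–Schur indicator of an object: the trace of the transposition map
`T_{X,X} : Hom(X, X^∨) → Hom(X, X^∨)`. -/
noncomputable def LinearDualityStruct.nu (dd : LinearDualityStruct k C) (X : C) : k :=
  LinearMap.trace k (X ⟶ dd.dObj X) (dd.transHom k X X)

open CategoryTheory.Limits

/-- Two-sided composition `f ↦ u ≫ f ≫ v^∨`. -/
def fsL (dd : LinearDualityStruct k C) {A B A' B' : C} (u : A ⟶ B) (v : A' ⟶ B') :
    (B ⟶ dd.dObj B') →ₗ[k] (A ⟶ dd.dObj A') where
  toFun f := u ≫ f ≫ dd.dMap v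
  map_add' f g := by simp
  map_smul' c f := by simp

theorem fsL_apply (dd : LinearDualityStruct k C) {A B A' B' : C} (u : A ⟶ B) (v : A' ⟶ B')
    (f : B ⟶ dd.dObj B') : fsL k dd u v f = u ≫ f ≫ dd.dMap v := rfl

theorem fsT_apply (dd : LinearDualityStruct k C) {A B : C}
    (f : A ⟶ dd.dObj B) : dd.transHom k A B f = dd.j B ≫ dd.dMap f := rfl

theorem fsT_L (dd : LinearDualityStruct k C) {A B A' B' : C} (u : A ⟶ B) (v : A' ⟶ B') :
    dd.transHom k A A' ∘ₗ fsL k dd u v = fsL k dd v u ∘ₗ dd.transHom k B B' := by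
  apply LinearMap.ext
  intro f
  rw [LinearMap.comp_apply, LinearMap.comp_apply, fsL_apply, fsL_apply, fsT_apply, fsT_apply,
    dd.dMap_comp, dd.dMap_comp, Category.assoc, Category.assoc, ← Category.assoc v,
    dd.j_natural, Category.assoc]

theorem fsL_L (dd : LinearDualityStruct k C) {A B D A' B' D' : C} (u : A ⟶ B) (v : A' ⟶ B')
    (u' : B ⟶ D) (v' : B' ⟶ D') :
    fsL k dd u v ∘ₗ fsL k dd u' v' = fsL k dd (u ≫ u') (v ≫ v') := by
  apply LinearMap.ext
  intro f
  simp [fsL_apply, dd.dMap_comp]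

theorem fsL_id (dd : LinearDualityStruct k C) (A B : C) :
    fsL k dd (𝟙 A) (𝟙 B) = LinearMap.id := by
  apply LinearMap.ext
  intro f
  simp [fsL_apply, dd.dMap_id]

theorem fsL_zero (dd : LinearDualityStruct k C) {A B A' B' : C} (v : A' ⟶ B') :
    fsL k dd (0 : A ⟶ B) v = 0 := by
  apply LinearMap.ext
  intro f
  simp [fsL_apply]

theorem fsL_add (dd : LinearDualityStruct k C) {A B A' B' : C} (u₁ u₂ : A ⟶ B)
    (v₁ v₂ : A' ⟶ B') :
    fsL k dd (u₁ + u₂) (v₁ + v₂) = (fsL k dd u₁ v₁ + fsL k dd u₂ v₂) +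
      (fsL k dd u₁ v₂ + fsL k dd u₂ v₁) := by
  apply LinearMap.ext
  intro f
  simp only [fsL_apply, LinearMap.add_apply, dd.dMap_add, Preadditive.comp_add,
    Preadditive.add_comp]
  abel

theorem fs_trace (dd : LinearDualityStruct k C)
    [∀ X Y : C, FiniteDimensional k (X ⟶ Y)] {X A B : C}
    (p : X ⟶ A) (i : A ⟶ X) (q : X ⟶ B) (l : B ⟶ X) :
    LinearMap.trace k _ (dd.transHom k X X ∘ₗ fsL k dd (p ≫ i) (q ≫ l)) =
      LinearMap.trace k _ (fsL k dd (i ≫ q) (l ≫ p) ∘ₗ dd.transHom k A B) := by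
  rw [← fsL_L, ← LinearMap.comp_assoc, LinearMap.trace_comp_comm', fsT_L,
    ← LinearMap.comp_assoc, fsL_L]

/-- Additivity of the FS indicator: `ν(X₁ ⊕ X₂) = ν(X₁) + ν(X₂)` whenever the biproduct
`X₁ ⊕ X₂` exists. -/
theorem nu_biprod (dd : LinearDualityStruct k C)
    [∀ X Y : C, FiniteDimensional k (X ⟶ Y)]
    (X₁ X₂ : C) [HasBinaryBiproduct X₁ X₂] :
    dd.nu k (X₁ ⊞ X₂) = dd.nu k X₁ + dd.nu k X₂ := by
  unfold LinearDualityStruct.nu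
  have h : dd.transHom k (X₁ ⊞ X₂) (X₁ ⊞ X₂) =
      dd.transHom k (X₁ ⊞ X₂) (X₁ ⊞ X₂) ∘ₗ
        fsL k dd (biprod.fst ≫ biprod.inl + biprod.snd ≫ biprod.inr)
          (biprod.fst ≫ biprod.inl + biprod.snd ≫ biprod.inr) := by
    rw [biprod.total, fsL_id, LinearMap.comp_id]
  rw [h, fsL_add, LinearMap.comp_add, LinearMap.comp_add, LinearMap.comp_add, map_add, map_add,
    map_add, fs_trace, fs_trace, fs_trace, fs_trace]
  simp [fsL_id, fsL_zero]
end

section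
/- Let C and D be categories with duality over a field k (with finite-dimensional Hom-spaces) and let (F, ξ) : C → D be a duality preserving functor in which ξ is a natural isomorphism (a strong duality preserving functor). If F is k-linear and fully faithful, then ν(F(X)) = ν(X) for all objects X of C. -/
open CategoryTheory

universe v u

variable (k : Type*) [Field k] {C : Type u} [Category.{v} C]
  [Preadditive C] [CategoryTheory.Linear k C]

/-- A `k`-linear fully faithful strong duality preserving functor preserves the FS
indicator: `ν(F(X)) = ν(X)`. -/
theorem nu_of_strong_duality_preserving
    {D : Type u} [Category.{v} D] [Preadditive D] [CategoryTheory.Linear k D]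
    (ddC : LinearDualityStruct k C) (ddD : LinearDualityStruct k D)
    [∀ X Y : C, FiniteDimensional k (X ⟶ Y)]
    [∀ X Y : D, FiniteDimensional k (X ⟶ Y)]
    (F : C ⥤ D) [F.Additive] [F.Linear k] [F.Full] [F.Faithful]
    (ξ : ∀ X : C, F.obj (ddC.dObj X) ⟶ ddD.dObj (F.obj X))
    (hξ_nat : ∀ {X Y : C} (f : X ⟶ Y),
      F.map (ddC.dMap f) ≫ ξ X = ξ Y ≫ ddD.dMap (F.map f))
    (hξ_iso : ∀ X : C, IsIso (ξ X))
    (hdp : ∀ X : C,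
      ddD.j (F.obj X) ≫ ddD.dMap (ξ X) = F.map (ddC.j X) ≫ ξ (ddC.dObj X)) :
    ∀ X : C, ddD.nu k (F.obj X) = ddC.nu k X := by
  intro X
  haveI := hξ_iso X
  let e₀ : (X ⟶ ddC.dObj X) →ₗ[k] (F.obj X ⟶ ddD.dObj (F.obj X)) :=
    { toFun := fun f => F.map f ≫ ξ X
      map_add' := fun f g => by rw [F.map_add, Preadditive.add_comp]
      map_smul' := fun c f => by
        rw [F.map_smul, CategoryTheory.Linear.smul_comp, RingHom.id_apply] }
  have hbij : Function.Bijective e₀ := by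
    constructor
    · intro f g h
      have h' : F.map f ≫ ξ X = F.map g ≫ ξ X := h
      exact F.map_injective ((cancel_mono (ξ X)).1 h')
    · intro g
      obtain ⟨f, hf⟩ := F.map_surjective (g ≫ inv (ξ X))
      refine ⟨f, ?_⟩
      show F.map f ≫ ξ X = g
      rw [hf, Category.assoc, IsIso.inv_hom_id, Category.comp_id]
  let e := LinearEquiv.ofBijective e₀ hbij
  have key : ∀ f, ddD.transHom k (F.obj X) (F.obj X) (e f) = e (ddC.transHom k X X f) := by
    intro f
    show ddD.j (F.obj X) ≫ ddD.dMap (F.map f ≫ ξ X) = F.map (ddC.j X ≫ ddC.dMap f) ≫ ξ X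
    rw [ddD.dMap_comp, ← Category.assoc, hdp, Category.assoc, ← hξ_nat, F.map_comp,
      Category.assoc]
  have hconj : ddD.transHom k (F.obj X) (F.obj X) = e.conj (ddC.transHom k X X) := by
    ext g
    rw [LinearEquiv.conj_apply_apply, ← key, LinearEquiv.apply_symm_apply]
  unfold LinearDualityStruct.nu
  rw [hconj, LinearMap.trace_conj']
end

section
/- Let C be an Abelian category with strong duality over a field k (with finite-dimensional Hom-spaces). If an object X of C is a finite biproduct of simple objects, then ν(X) = ν(X^∨). -/
open CategoryTheory

universe v u

open CategoryTheory.Limits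

attribute [local instance] CategoryTheory.Limits.HasFiniteBiproducts.of_hasFiniteProducts

namespace FSaux

variable {k : Type*} [Field k] {C : Type u} [Category.{v} C]

section lin
variable [Preadditive C] [CategoryTheory.Linear k C]

/-- Congruence action. -/
def act (dd : LinearDualityStruct k C) {X X' Y Y' : C} (a : X' ⟶ X) (b : Y' ⟶ Y) :
    (X ⟶ dd.dObj Y) →ₗ[k] (X' ⟶ dd.dObj Y') where
  toFun f := a ≫ f ≫ dd.dMap b
  map_add' f g := by simp
  map_smul' c f := by simp

theorem dMap_zero (dd : LinearDualityStruct k C) (X Y : C) : dd.dMap (0 : X ⟶ Y) = 0 := by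
  have := dd.dMap_smul (0 : k) (0 : X ⟶ Y)
  simpa using this

theorem dMap_sum (dd : LinearDualityStruct k C) {X Y : C} {n : ℕ} (f : Fin n → (X ⟶ Y)) :
    dd.dMap (∑ i, f i) = ∑ i, dd.dMap (f i) := by
  let φ : (X ⟶ Y) →+ (dd.dObj Y ⟶ dd.dObj X) :=
    { toFun := fun f => dd.dMap f, map_zero' := dMap_zero dd X Y, map_add' := dd.dMap_add }
  exact map_sum φ f Finset.univ

theorem trans_act (dd : LinearDualityStruct k C) {X X' Y Y' : C} (a : X' ⟶ X) (b : Y' ⟶ Y)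
    (g : X ⟶ dd.dObj Y) :
    dd.transHom k X' Y' (act dd a b g) = act dd b a (dd.transHom k X Y g) := by
  show dd.j Y' ≫ dd.dMap (a ≫ g ≫ dd.dMap b) = b ≫ (dd.j Y ≫ dd.dMap g) ≫ dd.dMap a
  rw [dd.dMap_comp, dd.dMap_comp, Category.assoc, ← Category.assoc, ← dd.j_natural]
  simp

theorem nu_sum (dd : LinearDualityStruct k C) [∀ X Y : C, FiniteDimensional k (X ⟶ Y)]
    {X : C} {n : ℕ} {V : Fin n → C} (ι : ∀ i, V i ⟶ X) (π : ∀ i, X ⟶ V i)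
    (h1 : ∀ i, ι i ≫ π i = 𝟙 _) (h0 : ∀ i j, i ≠ j → ι i ≫ π j = 0)
    (hs : ∑ i, π i ≫ ι i = 𝟙 X) : dd.nu k X = ∑ i, dd.nu k (V i) := by
  have hT : dd.transHom k X X = ∑ i, ∑ j, (dd.transHom k X X ∘ₗ act dd (π i) (π j)) ∘ₗ
      act dd (ι i) (ι j) := by
    ext f
    simp only [LinearMap.sum_apply, LinearMap.comp_apply]
    simp only [← map_sum]
    congr 1
    have : ∀ i j, act dd (π i) (π j) (act dd (ι i) (ι j) f) =
        (π i ≫ ι i) ≫ f ≫ dd.dMap (π j ≫ ι j) := by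
      intro i j
      show π i ≫ (ι i ≫ f ≫ dd.dMap (ι j)) ≫ dd.dMap (π j) = _
      rw [dd.dMap_comp]; simp
    simp only [this]
    simp only [← Preadditive.comp_sum, ← dMap_sum, hs, dd.dMap_id, ← Preadditive.sum_comp]
    simp
  unfold LinearDualityStruct.nu
  rw [hT]
  simp only [map_sum]
  refine Finset.sum_congr rfl fun i _ => ?_
  have key : ∀ j, (act dd (ι i) (ι j)) ∘ₗ (dd.transHom k X X ∘ₗ act dd (π i) (π j)) =
      act dd (ι i ≫ π j) (ι j ≫ π i) ∘ₗ dd.transHom k (V i) (V j) := by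
    intro j
    ext g
    simp only [LinearMap.comp_apply, trans_act]
    show ι i ≫ (π j ≫ _ ≫ dd.dMap (π i)) ≫ dd.dMap (ι j) = (ι i ≫ π j) ≫ _ ≫ dd.dMap (ι j ≫ π i)
    rw [dd.dMap_comp]; simp
  rw [Finset.sum_eq_single i]
  · rw [LinearMap.trace_comp_comm', key]
    congr 1
    ext g
    show (ι i ≫ π i) ≫ (dd.transHom k (V i) (V i) g) ≫ dd.dMap (ι i ≫ π i) = _
    rw [h1, dd.dMap_id]; simp
  · intro j _ hj
    rw [LinearMap.trace_comp_comm', key]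
    convert map_zero (LinearMap.trace k (V i ⟶ dd.dObj (V j)))
    ext g
    show (ι i ≫ π j) ≫ (dd.transHom k (V i) (V j) g) ≫ dd.dMap (ι j ≫ π i) = 0
    rw [h0 i j hj.symm]; simp
  · simp

theorem nu_iso (dd : LinearDualityStruct k C) [∀ X Y : C, FiniteDimensional k (X ⟶ Y)]
    {X Y : C} (e : X ≅ Y) : dd.nu k X = dd.nu k Y := by
  have := nu_sum dd (X := X) (n := 1) (V := fun _ => Y) (fun _ => e.inv) (fun _ => e.hom)
    (by simp) (fun i j h => (h (Subsingleton.elim _ _)).elim) (by simp)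
  simpa using this

theorem nu_zero (dd : LinearDualityStruct k C) {X : C} (h : ∀ f : X ⟶ dd.dObj X, f = 0) :
    dd.nu k X = 0 := by
  unfold LinearDualityStruct.nu
  convert map_zero (LinearMap.trace k (X ⟶ dd.dObj X))
  ext f
  rw [h f]; simp

theorem faithful (dd : LinearDualityStruct k C) [∀ X : C, IsIso (dd.j X)] {X Y : C}
    (f : X ⟶ Y) (h : dd.dMap f = 0) : f = 0 := by
  have := dd.j_natural f
  rw [h, dMap_zero, Limits.comp_zero] at this
  rw [← cancel_mono (dd.j Y), this, Limits.zero_comp]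

end lin

theorem nu_simple [Abelian C] [CategoryTheory.Linear k C]
    (dd : LinearDualityStruct k C) [∀ X : C, IsIso (dd.j X)]
    [∀ X Y : C, FiniteDimensional k (X ⟶ Y)] (V : C) [Simple V] :
    dd.nu k V = dd.nu k (dd.dObj V) := by
  by_cases hV : Nonempty (V ≅ dd.dObj V)
  · exact nu_iso dd hV.some
  rw [nu_zero dd, nu_zero dd]
  · intro g
    by_contra hg
    apply hV
    have hg1 : g ≫ inv (dd.j V) ≠ 0 := fun h => hg (by simpa using h)
    have hg2 : dd.dMap (g ≫ inv (dd.j V)) ≫ inv (dd.j V) ≠ 0 := fun h =>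
      hg1 (faithful dd _ (by simpa using h))
    have e1 := epi_of_nonzero_to_simple hg1
    have e2 := epi_of_nonzero_to_simple hg2
    generalize g ≫ inv (dd.j V) = g' at *
    have e3 : Epi (dd.dMap g') := by
      have := epi_comp (dd.dMap g' ≫ inv (dd.j V)) (dd.j V)
      simpa using this
    have : Mono g' := Preadditive.mono_of_cancel_zero _ fun a ha => by
      apply faithful dd
      have h := congrArg dd.dMap ha
      rw [dd.dMap_comp, dMap_zero] at h
      exact Limits.zero_of_epi_comp _ h
    have := isIso_of_mono_of_epi g'
    exact ⟨(asIso g').symm⟩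
  · intro f
    by_contra hf
    apply hV
    have hf2 : dd.j V ≫ dd.dMap f ≠ 0 := fun h =>
      hf (faithful dd _ (by simpa using h))
    have e1 := mono_of_nonzero_from_simple hf
    have e2 := mono_of_nonzero_from_simple hf2
    have e3 : Mono (dd.dMap f) := by
      have := mono_comp (inv (dd.j V)) (dd.j V ≫ dd.dMap f)
      simpa using this
    have : Epi f := Preadditive.epi_of_cancel_zero _ fun a ha => by
      apply faithful dd
      have h := congrArg dd.dMap ha
      rw [dd.dMap_comp, dMap_zero] at h
      exact Limits.zero_of_comp_mono _ h
    have := isIso_of_mono_of_epi f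
    exact ⟨asIso f⟩

end FSaux

/-- In an Abelian category with strong duality over k, if X is a finite biproduct of
simple objects then ν(X) = ν(X^∨). -/
theorem nu_dual_of_biproduct_of_simples
    {k : Type*} [Field k] {C : Type u} [Category.{v} C] [Abelian C]
    [CategoryTheory.Linear k C]
    (dd : LinearDualityStruct k C) [∀ X : C, IsIso (dd.j X)]
    [∀ X Y : C, FiniteDimensional k (X ⟶ Y)]
    (X : C)
    (hX : ∃ (n : ℕ) (V : Fin n → C), (∀ i, Simple (V i)) ∧ Nonempty (X ≅ ⨁ V)) :
    dd.nu k X = dd.nu k (dd.dObj X) := by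
  obtain ⟨n, V, hV, ⟨e⟩⟩ := hX
  have hs : ∑ i, (e.hom ≫ biproduct.π V i) ≫ (biproduct.ι V i ≫ e.inv) = 𝟙 X := by
    have : ∀ i, (e.hom ≫ biproduct.π V i) ≫ (biproduct.ι V i ≫ e.inv) =
        e.hom ≫ (biproduct.π V i ≫ biproduct.ι V i) ≫ e.inv := by simp
    simp only [this, ← Preadditive.comp_sum, ← Preadditive.sum_comp, biproduct.total]
    simp
  have h1 : ∀ i, (biproduct.ι V i ≫ e.inv) ≫ (e.hom ≫ biproduct.π V i) = 𝟙 _ := by simp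
  have h0 : ∀ i j, i ≠ j → (biproduct.ι V i ≫ e.inv) ≫ (e.hom ≫ biproduct.π V j) = 0 := by
    intro i j hij
    simp [biproduct.ι_π_ne V hij]
  rw [FSaux.nu_sum dd _ _ h1 h0 hs]
  rw [FSaux.nu_sum dd (X := dd.dObj X) (V := fun i => dd.dObj (V i))
    (fun i => dd.dMap (e.hom ≫ biproduct.π V i)) (fun i => dd.dMap (biproduct.ι V i ≫ e.inv))
    (fun i => by rw [← dd.dMap_comp, h1, dd.dMap_id])
    (fun i j hij => by rw [← dd.dMap_comp, h0 j i hij.symm, FSaux.dMap_zero])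
    (by simp only [← dd.dMap_comp, ← FSaux.dMap_sum, hs, dd.dMap_id])]
  refine Finset.sum_congr rfl fun i _ => ?_
  have := hV i
  exact FSaux.nu_simple dd (V i)
end

section
/- Let C be an Abelian category with strong duality over a field k of characteristic not 2 (with finite-dimensional Hom-spaces) and let X be an absolutely simple object of C, i.e., a simple object with End_C(X) ≅ k. Then ν(X) ∈ {0, +1, −1}, and ν(X) ≠ 0 if and only if X is self-dual, i.e., X is isomorphic to X^∨. -/
open CategoryTheory

universe v u

/-- For an absolutely simple object X of an Abelian category with strong duality over k
(char k ≠ 2): ν(X) ∈ {0, +1, −1}, and ν(X) ≠ 0 iff X is self-dual. -/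
theorem nu_of_absolutely_simple
    {k : Type*} [Field k] {C : Type u} [Category.{v} C] [Abelian C]
    [CategoryTheory.Linear k C]
    (dd : LinearDualityStruct k C) [∀ X : C, IsIso (dd.j X)]
    [∀ X Y : C, FiniteDimensional k (X ⟶ Y)]
    (hchar : (2 : k) ≠ 0)
    (X : C) [Simple X]
    (habs : Function.Bijective (fun c : k => (c • 𝟙 X : X ⟶ X))) :
    (dd.nu k X = 0 ∨ dd.nu k X = 1 ∨ dd.nu k X = -1) ∧
      (dd.nu k X ≠ 0 ↔ Nonempty (X ≅ dd.dObj X)) := by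
  have TT : ∀ f : X ⟶ dd.dObj X, dd.transHom k X X (dd.transHom k X X f) = f := by
    intro f
    change dd.j X ≫ dd.dMap (dd.j X ≫ dd.dMap f) = f
    rw [dd.dMap_comp, ← Category.assoc, ← dd.j_natural, Category.assoc, dd.coherence,
      Category.comp_id]
  have d0 : ∀ A B : C, dd.dMap (0 : A ⟶ B) = 0 := by
    intro A B
    have h := dd.dMap_smul (0 : k) (0 : A ⟶ B)
    simpa using h
  have hmono : ∀ f : X ⟶ dd.dObj X, f ≠ 0 → Mono f := fun f hf => mono_of_nonzero_from_simple hf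
  have hiso : ∀ f : X ⟶ dd.dObj X, f ≠ 0 → IsIso f := by
    intro f hf
    have hT : dd.transHom k X X f ≠ 0 := by
      intro h
      apply hf
      rw [← TT f, h, map_zero]
    have m1 := hmono f hf
    have m2 := hmono _ hT
    have e1 : dd.dMap f = inv (dd.j X) ≫ dd.transHom k X X f := by
      rw [IsIso.eq_inv_comp]
      rfl
    have m3 : Mono (dd.dMap f) := by
      rw [e1]
      infer_instance
    have ep : Epi f := by
      apply Preadditive.epi_of_cancel_zero
      intro Z g hg
      have h1 : dd.dMap g ≫ dd.dMap f = 0 := by rw [← dd.dMap_comp, hg, d0]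
      have h2 : dd.dMap g = 0 := Limits.zero_of_comp_mono _ h1
      have h3 : g ≫ dd.j Z = 0 := by rw [dd.j_natural, h2, d0, Limits.comp_zero]
      exact Limits.zero_of_comp_mono _ h3
    exact isIso_of_mono_of_epi f
  by_cases hne : ∃ f : X ⟶ dd.dObj X, f ≠ 0
  · obtain ⟨f, hf⟩ := hne
    have fi := hiso f hf
    have hspan : ∀ g : X ⟶ dd.dObj X, ∃ c : k, c • f = g := by
      intro g
      obtain ⟨c, hc⟩ := habs.2 (g ≫ inv f)
      refine ⟨c, ?_⟩
      have h := congrArg (· ≫ f) hc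
      simpa using h
    have hrank : Module.finrank k (X ⟶ dd.dObj X) = 1 :=
      (finrank_eq_one_iff_of_nonzero' f hf).2 hspan
    obtain ⟨c, hc⟩ := hspan (dd.transHom k X X f)
    have hTc : dd.transHom k X X = c • LinearMap.id := by
      apply LinearMap.ext
      intro g
      obtain ⟨a, rfl⟩ := hspan g
      rw [map_smul, ← hc]
      exact smul_comm a c f
    have hnu : dd.nu k X = c := by
      unfold LinearDualityStruct.nu
      rw [hTc, map_smul, LinearMap.trace_id, hrank]
      simp
    have hcc : c * c = 1 := by
      have h := TT f
      rw [← hc, map_smul, ← hc, smul_smul] at h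
      have h' : (c * c - 1) • f = 0 := by rw [sub_smul, h, one_smul, sub_self]
      rcases smul_eq_zero.1 h' with h | h
      · exact sub_eq_zero.1 h
      · exact absurd h hf
    rw [hnu]
    refine ⟨Or.inr (mul_self_eq_one_iff.1 hcc), fun _ => ⟨asIso f⟩, fun _ h => ?_⟩
    rw [h] at hcc
    simp at hcc
  · push Not at hne
    have hnu : dd.nu k X = 0 := by
      have : dd.transHom k X X = 0 := LinearMap.ext fun g => hne _
      unfold LinearDualityStruct.nu
      rw [this, map_zero]
    refine ⟨Or.inl hnu, fun h => absurd hnu h, ?_⟩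
    rintro ⟨e⟩
    exfalso
    apply id_nonzero X
    rw [← e.hom_inv_id, hne e.hom, Limits.zero_comp]
end

section
/- Let (C, (−)^∨, j) be a category with duality, let (F, G, η, ε) be an adjunction from C to itself (F left adjoint to G, with unit η : id → GF and counit ε : FG → id), and let ξ_X : F(X^∨) → G(X)^∨ be a natural transformation. Define ζ_X : G(X^∨) → F(X)^∨ as ζ_X = F(j_X)^∨ ∘ ξ^∨_{X^∨} ∘ j_{G(X^∨)}. Suppose that for all objects X, η_X^∨ ∘ ξ_{F(X)} ∘ F(ζ_X) = ε_{X^∨}. Then the assignment X ↦ X^♯ := G(X^∨), together with ω_X := G(ξ_{X^∨}) ∘ GF(j_X) ∘ η_X : X → X^♯♯, makes (C, (−)^♯, ω) a category with duality. If moreover (C, (−)^∨, j) is strong, then the following are equivalent: (1) F is an equivalence; (2) G is an equivalence; (3) (C, (−)^♯, ω) is strong. -/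
open CategoryTheory

universe v u

variable {C : Type u} [Category.{v} C]

/-- The natural transformation `ζ_X = F(j_X)^∨ ∘ ξ^∨_{X^∨} ∘ j_{G(X^∨)} : G(X^∨) → F(X)^∨`. -/
def zeta (dd : DualityStruct C) (F G : C ⥤ C)
    (ξ : ∀ X : C, F.obj (dd.dObj X) ⟶ dd.dObj (G.obj X)) (X : C) :
    G.obj (dd.dObj X) ⟶ dd.dObj (F.obj X) :=
  dd.j (G.obj (dd.dObj X)) ≫ dd.dMap (ξ (dd.dObj X)) ≫ dd.dMap (F.map (dd.j X))

/-- The twisted pivotal morphism `ω_X = G(ξ_{X^∨}) ∘ GF(j_X) ∘ η_X : X → X^♯♯`,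
where `X^♯ = G(X^∨)`. -/
def omega (dd : DualityStruct C) (F G : C ⥤ C) (η : 𝟭 C ⟶ F ⋙ G)
    (ξ : ∀ X : C, F.obj (dd.dObj X) ⟶ dd.dObj (G.obj X)) (X : C) :
    X ⟶ G.obj (dd.dObj (G.obj (dd.dObj X))) :=
  η.app X ≫ G.map (F.map (dd.j X)) ≫ G.map (ξ (dd.dObj X))

namespace DualityStruct

/-- The duality as a functor to the opposite category. -/
def toOp (dd : DualityStruct C) : C ⥤ Cᵒᵖ where
  obj X := Opposite.op (dd.dObj X)
  map f := (dd.dMap f).op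
  map_id X := by rw [dd.dMap_id]; rfl
  map_comp f g := by rw [dd.dMap_comp]; rfl

/-- The duality as a functor from the opposite category. -/
def ofOp (dd : DualityStruct C) : Cᵒᵖ ⥤ C where
  obj X := dd.dObj X.unop
  map f := dd.dMap f.unop
  map_id X := dd.dMap_id _
  map_comp f g := dd.dMap_comp _ _

/-- The self-adjunction of the duality. -/
def adj (dd : DualityStruct C) : dd.toOp ⊣ dd.ofOp where
  unit := { app := fun X => dd.j X, naturality := fun _ _ f => dd.j_natural f }
  counit :=
    { app := fun X => (dd.j X.unop).op
      naturality := fun _ _ f => Quiver.Hom.unop_inj (dd.j_natural f.unop).symm }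
  left_triangle_components X := Quiver.Hom.unop_inj (dd.coherence X)
  right_triangle_components X := dd.coherence X.unop

theorem isEquivalence_iff (dd : DualityStruct C) :
    dd.toOp.IsEquivalence ↔ ∀ X, IsIso (dd.j X) := by
  constructor
  · intro h X
    exact (inferInstance : IsIso (dd.adj.unit.app X))
  · intro h
    haveI : ∀ X, IsIso (dd.adj.unit.app X) := h
    haveI : ∀ X, IsIso (dd.adj.counit.app X) := fun X =>
      (inferInstance : IsIso (dd.j X.unop).op)
    exact dd.adj.toEquivalence.isEquivalence_functor

end DualityStruct

/-- Twisting the duality of a category with duality by a twisting adjunction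
`(F, G, η, ε, ξ)`: the twisted duality `X ↦ X^♯ = G(X^∨)` with twisted pivotal morphism `ω`
is again a category with duality (pivotal naturality and coherence, the first two
conjuncts), and, if the original duality is strong, then `F` is an equivalence iff `G` is
an equivalence iff the twisted duality is strong. -/
theorem twisted_duality
    (dd : DualityStruct C) (F G : C ⥤ C)
    (η : 𝟭 C ⟶ F ⋙ G) (ε : G ⋙ F ⟶ 𝟭 C)
    (hcu₁ : ∀ X : C, F.map (η.app X) ≫ ε.app (F.obj X) = 𝟙 (F.obj X))
    (hcu₂ : ∀ X : C, η.app (G.obj X) ≫ G.map (ε.app X) = 𝟙 (G.obj X))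
    (ξ : ∀ X : C, F.obj (dd.dObj X) ⟶ dd.dObj (G.obj X))
    (hξ_nat : ∀ {X Y : C} (f : X ⟶ Y),
      F.map (dd.dMap f) ≫ ξ X = ξ Y ≫ dd.dMap (G.map f))
    (htw : ∀ X : C,
      F.map (zeta dd F G ξ X) ≫ ξ (F.obj X) ≫ dd.dMap (η.app X) = ε.app (dd.dObj X)) :
    -- ω is natural with respect to the twisted duality functor X ↦ G(X^∨)
    (∀ {X Y : C} (f : X ⟶ Y),
        f ≫ omega dd F G η ξ Y =
          omega dd F G η ξ X ≫ G.map (dd.dMap (G.map (dd.dMap f)))) ∧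
    -- coherence of ω: (C, (−)^♯, ω) is a category with duality
    (∀ X : C,
        omega dd F G η ξ (G.obj (dd.dObj X)) ≫ G.map (dd.dMap (omega dd F G η ξ X)) =
          𝟙 (G.obj (dd.dObj X))) ∧
    -- if the original duality is strong: F equivalence ↔ G equivalence ↔ twisted duality strong
    ((∀ X : C, IsIso (dd.j X)) →
      ((F.IsEquivalence ↔ G.IsEquivalence) ∧
        (G.IsEquivalence ↔ ∀ X : C, IsIso (omega dd F G η ξ X)))) := by
  have nat : ∀ {X Y : C} (f : X ⟶ Y),
        f ≫ omega dd F G η ξ Y =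
          omega dd F G η ξ X ≫ G.map (dd.dMap (G.map (dd.dMap f))) := by
    intro X Y f
    have h := η.naturality f
    simp only [Functor.id_map, Functor.comp_map] at h
    unfold omega
    rw [← Category.assoc, h]
    simp only [Category.assoc, ← G.map_comp]
    rw [← hξ_nat, ← Category.assoc, ← F.map_comp, dd.j_natural, F.map_comp, Category.assoc]
  have coh : ∀ X : C,
        omega dd F G η ξ (G.obj (dd.dObj X)) ≫ G.map (dd.dMap (omega dd F G η ξ X)) =
          𝟙 (G.obj (dd.dObj X)) := by
    intro X
    rw [← hcu₂ (dd.dObj X), ← htw X]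
    unfold omega zeta
    simp only [Category.assoc, ← G.map_comp, dd.dMap_comp, F.map_comp]
    congr 3
    rw [← Category.assoc (F.map (dd.dMap (F.map (dd.j X)))), hξ_nat, Category.assoc,
      ← Category.assoc (F.map (dd.dMap (ξ (dd.dObj X)))), hξ_nat]
    simp only [Category.assoc, dd.dMap_comp, G.map_comp]
  refine ⟨nat, coh, fun hj => ?_⟩
  let A : F ⊣ G :=
    { unit := η
      counit := ε
      left_triangle_components := hcu₁
      right_triangle_components := hcu₂ }
  let dd' : DualityStruct C :=
    { dObj := fun X => G.obj (dd.dObj X)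
      dMap := fun f => G.map (dd.dMap f)
      dMap_id := fun X => by rw [dd.dMap_id, G.map_id]
      dMap_comp := fun f g => by rw [dd.dMap_comp, G.map_comp]
      j := omega dd F G η ξ
      j_natural := nat
      coherence := coh }
  haveI hS : dd.toOp.IsEquivalence := dd.isEquivalence_iff.2 hj
  have key : (dd.toOp ⋙ G.op).IsEquivalence ↔ ∀ X : C, IsIso (omega dd F G η ξ X) :=
    dd'.isEquivalence_iff
  refine ⟨⟨fun h => A.isEquivalence_right_of_isEquivalence_left, fun h => A.isEquivalence_left_of_isEquivalence_right⟩, ?_⟩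
  rw [← key]
  constructor
  · intro h
    infer_instance
  · intro h
    haveI : G.op.IsEquivalence := Functor.isEquivalence_of_comp_left dd.toOp G.op
    exact (inferInstance : (opOp C ⋙ G.op.op ⋙ unopUnop C).IsEquivalence)
end

section
/- Let (A, S, g) be a pivotal algebra over a field k of characteristic not 2, and let V be a finite-dimensional left A-module which is absolutely simple (End_A(V) = k·id). Then ν(V) ∈ {0, +1, −1}, and the following are equivalent: (1) ν(V) ≠ 0; (2) V is isomorphic to its dual module V^∨ as a left A-module; (3) there exists a nondegenerate bilinear form b on V with b(av, w) = b(v, S(a)w) for all a ∈ A and v, w ∈ V. Moreover, if these hold, such a bilinear form b is unique up to scalar multiples and satisfies b(w, g v) = ν(V) · b(v, w) for all v, w ∈ V. -/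
/-- A pivotal algebra `(A, S, g)`: a `k`-algebra `A` with an anti-algebra map `S` and an
invertible element `g` such that `S(g) = g⁻¹` and `S²(a) = g a g⁻¹` for all `a`. -/
structure PivotalAlgebra (k : Type*) (A : Type*) [Field k] [Ring A] [Algebra k A] where
  S : A →ₗ[k] A
  S_mul : ∀ x y : A, S (x * y) = S y * S x
  S_one : S 1 = 1
  g : Aˣ
  S_g : S ↑g = ↑g⁻¹
  S_S : ∀ a : A, S (S a) = ↑g * a * ↑g⁻¹

variable {k A : Type*} [Field k] [Ring A] [Algebra k A]
variable {V : Type*} [AddCommGroup V] [Module k V]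

/-- A bilinear form `b` on an `A`-module `V` (given by `ρ : A →ₐ End_k(V)`) is
`A`-invariant if `b(av, w) = b(v, S(a)w)` for all `a ∈ A`, `v, w ∈ V`. -/
def IsInvariantBil (P : PivotalAlgebra k A) (ρ : A →ₐ[k] Module.End k V)
    (b : V →ₗ[k] V →ₗ[k] k) : Prop :=
  ∀ (a : A) (v w : V), b (ρ a v) w = b v (ρ (P.S a) w)

/-- A bilinear form `b` on `V` is nondegenerate. -/
def IsNondegBil (b : V →ₗ[k] V →ₗ[k] k) : Prop :=
  (∀ v : V, (∀ w : V, b v w = 0) → v = 0) ∧ (∀ w : V, (∀ v : V, b v w = 0) → w = 0)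

/-- `Bil_A^+(V)`: the space of `A`-invariant bilinear forms with `b(w, gv) = b(v, w)`. -/
def BilPlus (P : PivotalAlgebra k A) (ρ : A →ₐ[k] Module.End k V) :
    Submodule k (V →ₗ[k] V →ₗ[k] k) where
  carrier := {b | IsInvariantBil P ρ b ∧ ∀ v w : V, b w (ρ ↑P.g v) = b v w}
  add_mem' := by
    rintro b c ⟨hb1, hb2⟩ ⟨hc1, hc2⟩
    exact ⟨fun a v w => by simp [hb1 a v w, hc1 a v w],
      fun v w => by simp [hb2 v w, hc2 v w]⟩
  zero_mem' := ⟨fun a v w => by simp, fun v w => by simp⟩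
  smul_mem' := by
    rintro c b ⟨hb1, hb2⟩
    exact ⟨fun a v w => by simp [hb1 a v w], fun v w => by simp [hb2 v w]⟩

/-- `Bil_A^-(V)`: the space of `A`-invariant bilinear forms with `b(w, gv) = -b(v, w)`. -/
def BilMinus (P : PivotalAlgebra k A) (ρ : A →ₐ[k] Module.End k V) :
    Submodule k (V →ₗ[k] V →ₗ[k] k) where
  carrier := {b | IsInvariantBil P ρ b ∧ ∀ v w : V, b w (ρ ↑P.g v) = - b v w}
  add_mem' := by
    rintro b c ⟨hb1, hb2⟩ ⟨hc1, hc2⟩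
    refine ⟨fun a v w => by simp [hb1 a v w, hc1 a v w],
      fun v w => by simp [hb2 v w, hc2 v w]; ring⟩
  zero_mem' := ⟨fun a v w => by simp, fun v w => by simp⟩
  smul_mem' := by
    rintro c b ⟨hb1, hb2⟩
    exact ⟨fun a v w => by simp [hb1 a v w], fun v w => by simp [hb2 v w]⟩

/-- The Frobenius–Schur indicator `ν(V) = dim Bil_A^+(V) − dim Bil_A^-(V)`. -/
noncomputable def fsIndicator (P : PivotalAlgebra k A) (ρ : A →ₐ[k] Module.End k V) : ℤ :=
  (Module.finrank k (BilPlus P ρ) : ℤ) - (Module.finrank k (BilMinus P ρ) : ℤ)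

theorem piv_S_surj (P : PivotalAlgebra k A) (a : A) : ∃ x, P.S x = a := by
  refine ⟨P.S (↑P.g⁻¹ * a * ↑P.g), ?_⟩
  rw [P.S_S]
  simp [mul_assoc]

theorem piv_nondeg (P : PivotalAlgebra k A) (ρ : A →ₐ[k] Module.End k V)
    (hsimple : ∀ W : Submodule k V, (∀ (a : A), ∀ v ∈ W, ρ a v ∈ W) → W = ⊥ ∨ W = ⊤)
    (b : V →ₗ[k] V →ₗ[k] k) (hb : IsInvariantBil P ρ b) (h0 : b ≠ 0) : IsNondegBil b := by
  constructor
  · rcases hsimple (LinearMap.ker b) (by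
      intro a v hv
      rw [LinearMap.mem_ker] at hv ⊢
      ext w
      rw [hb a v w, hv]; simp) with h | h
    · intro v hv
      have : v ∈ LinearMap.ker b := by
        rw [LinearMap.mem_ker]; ext w; exact hv w
      rw [h] at this
      simpa using this
    · exact absurd (LinearMap.ker_eq_top.1 h) h0
  · rcases hsimple (LinearMap.ker b.flip) (by
      intro a v hv
      rw [LinearMap.mem_ker] at hv ⊢
      obtain ⟨x, rfl⟩ := piv_S_surj P a
      ext w
      rw [LinearMap.flip_apply, ← hb x w v, ← LinearMap.flip_apply, hv]; simp) with h | h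
    · intro v hv
      have : v ∈ LinearMap.ker b.flip := by
        rw [LinearMap.mem_ker]; ext w; exact hv w
      rw [h] at this
      simpa using this
    · refine absurd ?_ h0
      have h2 := LinearMap.ker_eq_top.1 h
      ext v w
      have := LinearMap.congr_fun (LinearMap.congr_fun h2 w) v
      simpa using this

theorem piv_equiv [FiniteDimensional k V] (b : V →ₗ[k] V →ₗ[k] k) (hn : IsNondegBil b) :
    ∃ φ : V ≃ₗ[k] Module.Dual k V, ∀ v, φ v = b v := by
  have hinj : Function.Injective (b : V →ₗ[k] Module.Dual k V) := by
    rw [← LinearMap.ker_eq_bot, LinearMap.ker_eq_bot']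
    intro v hv
    exact hn.1 v (fun w => by rw [hv]; simp)
  exact ⟨LinearEquiv.ofInjectiveOfFinrankEq (b : V →ₗ[k] Module.Dual k V) hinj
    (Subspace.dual_finrank_eq).symm, fun v => rfl⟩

theorem piv_unique [FiniteDimensional k V] (P : PivotalAlgebra k A)
    (ρ : A →ₐ[k] Module.End k V)
    (habs : ∀ f : Module.End k V,
      (∀ a : A, f ∘ₗ ρ a = ρ a ∘ₗ f) → ∃ c : k, f = c • LinearMap.id)
    (b : V →ₗ[k] V →ₗ[k] k) (hb : IsInvariantBil P ρ b) (hn : IsNondegBil b)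
    (b' : V →ₗ[k] V →ₗ[k] k) (hb' : IsInvariantBil P ρ b') : ∃ c : k, b' = c • b := by
  obtain ⟨φ, hφ⟩ := piv_equiv b hn
  have key : ∀ v, b (φ.symm (b' v)) = b' v := fun v => by
    rw [← hφ]; exact φ.apply_symm_apply _
  obtain ⟨c, hc⟩ := habs (φ.symm.toLinearMap ∘ₗ (b' : V →ₗ[k] Module.Dual k V)) (by
    intro a
    ext v
    apply φ.injective
    simp only [LinearMap.comp_apply, LinearEquiv.coe_coe, hφ]
    ext w
    rw [hb, key, key, hb'])
  refine ⟨c, ?_⟩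
  ext v w
  have h := LinearMap.congr_fun hc v
  simp only [LinearMap.comp_apply, LinearEquiv.coe_coe, LinearMap.smul_apply,
    LinearMap.id_apply] at h
  rw [← key v, h]
  simp

theorem piv_sign [FiniteDimensional k V] [Nontrivial V] (P : PivotalAlgebra k A)
    (ρ : A →ₐ[k] Module.End k V)
    (habs : ∀ f : Module.End k V,
      (∀ a : A, f ∘ₗ ρ a = ρ a ∘ₗ f) → ∃ c : k, f = c • LinearMap.id)
    (b : V →ₗ[k] V →ₗ[k] k) (hb : IsInvariantBil P ρ b) (hn : IsNondegBil b) (h0 : b ≠ 0) :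
    (∀ v w : V, b w (ρ ↑P.g v) = b v w) ∨ (∀ v w : V, b w (ρ ↑P.g v) = - b v w) := by
  obtain ⟨c, hc⟩ := piv_unique P ρ habs b hb hn (b.flip ∘ₗ ρ ↑P.g) (by
    intro a v w
    simp only [LinearMap.comp_apply, LinearMap.flip_apply]
    rw [hb, P.S_S, ← Module.End.mul_apply, ← Module.End.mul_apply, ← map_mul, ← map_mul]
    simp [mul_assoc])
  have h : ∀ v w : V, b w (ρ ↑P.g v) = c * b v w := fun v w => by
    have := LinearMap.congr_fun (LinearMap.congr_fun hc v) w
    simpa using this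
  have hcc : c * c = 1 := by
    obtain ⟨v, w, hvw⟩ : ∃ v w, b v w ≠ 0 := by
      by_contra! hh
      exact h0 (by ext v w; simp [hh])
    have h1 : b (ρ ↑P.g v) (ρ ↑P.g w) = b v w := by
      rw [hb, P.S_g, ← Module.End.mul_apply, ← map_mul]
      simp
    rw [h, h, ← mul_assoc] at h1
    exact mul_right_cancel₀ hvw (by rw [h1, one_mul])
  rcases mul_self_eq_one_iff.1 hcc with rfl | rfl
  · left; intro v w; rw [h, one_mul]
  · right; intro v w; rw [h, neg_one_mul]

theorem piv_span [FiniteDimensional k V] (P : PivotalAlgebra k A)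
    (ρ : A →ₐ[k] Module.End k V)
    (habs : ∀ f : Module.End k V,
      (∀ a : A, f ∘ₗ ρ a = ρ a ∘ₗ f) → ∃ c : k, f = c • LinearMap.id)
    (hchar : (2 : k) ≠ 0)
    (b : V →ₗ[k] V →ₗ[k] k) (hb : IsInvariantBil P ρ b) (hn : IsNondegBil b) (h0 : b ≠ 0) :
    ((∀ v w : V, b w (ρ ↑P.g v) = b v w) → fsIndicator P ρ = 1) ∧
    ((∀ v w : V, b w (ρ ↑P.g v) = - b v w) → fsIndicator P ρ = -1) := by
  obtain ⟨v, w, hvw⟩ : ∃ v w, b v w ≠ 0 := by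
    by_contra! hh
    exact h0 (by ext v w; simp [hh])
  constructor
  · intro h
    have h1 : BilPlus P ρ = Submodule.span k {b} := by
      apply le_antisymm
      · rintro x ⟨hx, -⟩
        obtain ⟨c, rfl⟩ := piv_unique P ρ habs b hb hn x hx
        exact Submodule.smul_mem _ _ (Submodule.mem_span_singleton_self b)
      · rw [Submodule.span_singleton_le_iff_mem]
        exact ⟨hb, h⟩
    have h2 : BilMinus P ρ = ⊥ := by
      rw [eq_bot_iff]
      rintro x ⟨hx, hx2⟩
      obtain ⟨c, rfl⟩ := piv_unique P ρ habs b hb hn x hx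
      have h3 := hx2 v w
      simp only [LinearMap.smul_apply, smul_eq_mul, h] at h3
      have h4 : (2 * c) * b v w = 0 := by linear_combination h3
      have : c = 0 := by simpa [hvw, hchar] using h4
      simp [this]
    have hf : Module.finrank k (Submodule.span k {b}) = 1 :=
      finrank_span_singleton (K := k) (v := b) h0
    rw [fsIndicator, h1, h2, hf, finrank_bot]; norm_num
  · intro h
    have h1 : BilMinus P ρ = Submodule.span k {b} := by
      apply le_antisymm
      · rintro x ⟨hx, -⟩
        obtain ⟨c, rfl⟩ := piv_unique P ρ habs b hb hn x hx
        exact Submodule.smul_mem _ _ (Submodule.mem_span_singleton_self b)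
      · rw [Submodule.span_singleton_le_iff_mem]
        exact ⟨hb, h⟩
    have h2 : BilPlus P ρ = ⊥ := by
      rw [eq_bot_iff]
      rintro x ⟨hx, hx2⟩
      obtain ⟨c, rfl⟩ := piv_unique P ρ habs b hb hn x hx
      have h3 := hx2 v w
      simp only [LinearMap.smul_apply, smul_eq_mul, h] at h3
      have h4 : (2 * c) * b v w = 0 := by linear_combination -h3
      have : c = 0 := by simpa [hvw, hchar] using h4
      simp [this]
    have hf : Module.finrank k (Submodule.span k {b}) = 1 :=
      finrank_span_singleton (K := k) (v := b) h0
    rw [fsIndicator, h1, h2, hf, finrank_bot]; norm_num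

/-- The Frobenius–Schur theorem for pivotal algebras: if V is a finite-dimensional
absolutely simple left A-module, then ν(V) ∈ {0, ±1}; ν(V) ≠ 0 iff V ≅ V^∨ iff there
exists a nondegenerate invariant bilinear form on V; and such a form is unique up to
scalars and satisfies b(w, gv) = ν(V)·b(v, w). -/
theorem pivotal_fs_theorem
    (hchar : (2 : k) ≠ 0)
    [FiniteDimensional k V] [Nontrivial V]
    (P : PivotalAlgebra k A) (ρ : A →ₐ[k] Module.End k V)
    (hsimple : ∀ W : Submodule k V, (∀ (a : A), ∀ v ∈ W, ρ a v ∈ W) → W = ⊥ ∨ W = ⊤)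
    (habs : ∀ f : Module.End k V,
      (∀ a : A, f ∘ₗ ρ a = ρ a ∘ₗ f) → ∃ c : k, f = c • LinearMap.id) :
    (fsIndicator P ρ = 0 ∨ fsIndicator P ρ = 1 ∨ fsIndicator P ρ = -1) ∧
    (fsIndicator P ρ ≠ 0 ↔
      ∃ φ : V ≃ₗ[k] Module.Dual k V, ∀ (a : A) (v : V), φ (ρ a v) = (φ v) ∘ₗ ρ (P.S a)) ∧
    (fsIndicator P ρ ≠ 0 ↔
      ∃ b : V →ₗ[k] V →ₗ[k] k, IsInvariantBil P ρ b ∧ IsNondegBil b) ∧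
    (∀ b : V →ₗ[k] V →ₗ[k] k, IsInvariantBil P ρ b → IsNondegBil b →
      ((∀ v w : V, b w (ρ ↑P.g v) = (fsIndicator P ρ : k) * b v w) ∧
        (∀ b' : V →ₗ[k] V →ₗ[k] k, IsInvariantBil P ρ b' → IsNondegBil b' →
          ∃ c : k, b' = c • b))) := by
  have hne : ∀ b : V →ₗ[k] V →ₗ[k] k, IsNondegBil b → b ≠ 0 := by
    rintro b hn rfl
    obtain ⟨v, hv⟩ := exists_ne (0 : V)
    exact hv (hn.1 v (by simp))
  have hval : ∀ b : V →ₗ[k] V →ₗ[k] k, IsInvariantBil P ρ b → IsNondegBil b →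
      (fsIndicator P ρ = 1 ∧ ∀ v w : V, b w (ρ ↑P.g v) = b v w) ∨
      (fsIndicator P ρ = -1 ∧ ∀ v w : V, b w (ρ ↑P.g v) = - b v w) := by
    intro b hb hn
    have h0 := hne b hn
    have hs := piv_span P ρ habs hchar b hb hn h0
    rcases piv_sign P ρ habs b hb hn h0 with h | h
    · exact Or.inl ⟨hs.1 h, h⟩
    · exact Or.inr ⟨hs.2 h, h⟩
  have hex : fsIndicator P ρ ≠ 0 ↔
      ∃ b : V →ₗ[k] V →ₗ[k] k, IsInvariantBil P ρ b ∧ IsNondegBil b := by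
    constructor
    · intro h
      by_contra! hno
      have hz : ∀ b : V →ₗ[k] V →ₗ[k] k, IsInvariantBil P ρ b → b = 0 := by
        intro b hb
        by_contra h0
        exact hno b hb (piv_nondeg P ρ hsimple b hb h0)
      have h1 : BilPlus P ρ = ⊥ := by
        rw [eq_bot_iff]; rintro x ⟨hx, -⟩; simpa using hz x hx
      have h2 : BilMinus P ρ = ⊥ := by
        rw [eq_bot_iff]; rintro x ⟨hx, -⟩; simpa using hz x hx
      apply h
      rw [fsIndicator, h1, h2, finrank_bot]; simp
    · rintro ⟨b, hb, hn⟩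
      rcases hval b hb hn with h | h <;> rw [h.1] <;> norm_num
  refine ⟨?_, ?_, hex, ?_⟩
  · by_cases h : fsIndicator P ρ = 0
    · exact Or.inl h
    · obtain ⟨b, hb, hn⟩ := hex.1 h
      rcases hval b hb hn with h | h
      · exact Or.inr (Or.inl h.1)
      · exact Or.inr (Or.inr h.1)
  · rw [hex]
    constructor
    · rintro ⟨b, hb, hn⟩
      obtain ⟨φ, hφ⟩ := piv_equiv b hn
      refine ⟨φ, fun a v => ?_⟩
      ext w
      rw [hφ, hφ]
      exact hb a v w
    · rintro ⟨φ, hφ⟩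
      have hb : IsInvariantBil P ρ φ.toLinearMap := fun a v w =>
        LinearMap.congr_fun (hφ a v) w
      refine ⟨φ.toLinearMap, hb, piv_nondeg P ρ hsimple _ hb ?_⟩
      intro h0
      obtain ⟨v, hv⟩ := exists_ne (0 : V)
      apply hv
      apply φ.injective
      rw [map_zero]
      exact LinearMap.congr_fun h0 v
  · intro b hb hn
    refine ⟨?_, fun b' hb' _ => piv_unique P ρ habs b hb hn b' hb'⟩
    rcases hval b hb hn with h | h
    · intro v w; rw [h.2, h.1]; simp
    · intro v w; rw [h.2, h.1]; simp
end

section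
/- Let (A, S, g) be a finite-dimensional pivotal algebra over a field k of characteristic not 2, and let reg_A denote A regarded as a left module over itself. Then ν(reg_A) = Trace(Q), where Q : A → A is the k-linear map Q(a) = S(a)g. -/
variable {k A : Type*} [Field k] [Ring A] [Algebra k A]
variable {V : Type*} [AddCommGroup V] [Module k V]

theorem trace_involution_aux {W : Type*} [AddCommGroup W] [Module k W] [FiniteDimensional k W]
    (hchar : (2 : k) ≠ 0) (T : W →ₗ[k] W) (hT : ∀ x, T (T x) = x) :
    LinearMap.trace k W T = (Module.finrank k (LinearMap.ker (T - LinearMap.id)) : k)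
      - (Module.finrank k (LinearMap.ker (T + LinearMap.id)) : k) := by
  have h1 : LinearMap.IsProj (LinearMap.ker (T - LinearMap.id))
      ((2 : k)⁻¹ • (LinearMap.id + T)) := by
    constructor
    · intro x
      simp only [LinearMap.mem_ker, LinearMap.sub_apply, LinearMap.smul_apply,
        LinearMap.add_apply, LinearMap.id_apply, map_smul, map_add, hT]
      module
    · intro x hx
      have hx' : T x = x := by simpa [sub_eq_zero] using hx
      simp only [LinearMap.smul_apply, LinearMap.add_apply, LinearMap.id_apply, hx']
      rw [← two_smul k x, smul_smul, inv_mul_cancel₀ hchar, one_smul]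
  have h2 : LinearMap.IsProj (LinearMap.ker (T + LinearMap.id))
      ((2 : k)⁻¹ • (LinearMap.id - T)) := by
    constructor
    · intro x
      simp only [LinearMap.mem_ker, LinearMap.sub_apply, LinearMap.smul_apply,
        LinearMap.add_apply, LinearMap.id_apply, map_smul, map_sub, hT]
      module
    · intro x hx
      have hx' : T x = -x := by simpa [add_eq_zero_iff_eq_neg] using hx
      simp only [LinearMap.smul_apply, LinearMap.sub_apply, LinearMap.id_apply, hx',
        sub_neg_eq_add]
      rw [← two_smul k x, smul_smul, inv_mul_cancel₀ hchar, one_smul]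
  rw [← h1.trace, ← h2.trace, ← map_sub]
  congr 1
  ext x
  simp only [LinearMap.smul_apply, LinearMap.sub_apply, LinearMap.add_apply, LinearMap.id_apply]
  rw [← smul_sub, add_sub_sub_cancel, ← two_smul k (T x), smul_smul, inv_mul_cancel₀ hchar,
    one_smul]

/-- The map `Q(a) = S(a) g`. -/
def Qaux (P : PivotalAlgebra k A) : A →ₗ[k] A := (LinearMap.mulRight k (↑P.g : A)) ∘ₗ P.S

theorem Qaux_apply (P : PivotalAlgebra k A) (a : A) : Qaux P a = P.S a * ↑P.g := rfl

theorem Qaux_Qaux (P : PivotalAlgebra k A) (a : A) : Qaux P (Qaux P a) = a := by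
  simp [Qaux_apply, P.S_mul, P.S_g, P.S_S, mul_assoc]

theorem Qaux_mul (P : PivotalAlgebra k A) (v w : A) :
    Qaux P (P.S v * w) = P.S w * (↑P.g * v) := by
  simp [Qaux_apply, P.S_mul, P.S_S, mul_assoc]

/-- The form `b(v,w) = φ(S(v) w)`. -/
def formAux (P : PivotalAlgebra k A) (φ : Module.Dual k A) : A →ₗ[k] A →ₗ[k] k :=
  ((LinearMap.mul k A).compr₂ φ) ∘ₗ P.S

theorem formAux_apply (P : PivotalAlgebra k A) (φ : Module.Dual k A) (v w : A) :
    formAux P φ v w = φ (P.S v * w) := rfl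

theorem formAux_inv (P : PivotalAlgebra k A) (φ : Module.Dual k A) :
    IsInvariantBil P (Algebra.lmul k A) (formAux P φ) := by
  intro a v w
  simp [formAux_apply, P.S_mul, mul_assoc]

theorem inv_apply_aux (P : PivotalAlgebra k A) (b : A →ₗ[k] A →ₗ[k] k)
    (hb : IsInvariantBil P (Algebra.lmul k A) b) (v w : A) : b 1 (P.S v * w) = b v w := by
  have := hb v 1 w
  simpa using this.symm

/-- symmetric forms -/
def plusEquiv (P : PivotalAlgebra k A) : BilPlus P (Algebra.lmul k A) ≃ₗ[k]
    LinearMap.ker (Module.Dual.transpose (R := k) (Qaux P) - LinearMap.id) where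
  toFun b := ⟨b.1 1, by
    obtain ⟨b, h1, h2⟩ := b
    rw [LinearMap.mem_ker, LinearMap.sub_apply, sub_eq_zero]
    ext w
    have h := h2 1 w
    have h' := inv_apply_aux P b h1 w P.g
    simp at h
    exact h'.trans h⟩
  map_add' _ _ := rfl
  map_smul' _ _ := rfl
  invFun φ := ⟨formAux P φ.1, formAux_inv P φ.1, fun v w => by
    obtain ⟨φ, h⟩ := φ
    rw [LinearMap.mem_ker, LinearMap.sub_apply, sub_eq_zero] at h
    have h' : φ (Qaux P (P.S v * w)) = φ (P.S v * w) := LinearMap.congr_fun h _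
    rw [Qaux_mul] at h'
    exact h'⟩
  left_inv b := by
    apply Subtype.ext
    ext v w
    exact inv_apply_aux P b.1 b.2.1 v w
  right_inv φ := by
    apply Subtype.ext
    ext w
    simp [formAux_apply, P.S_one]

/-- skew forms -/
def minusEquiv (P : PivotalAlgebra k A) : BilMinus P (Algebra.lmul k A) ≃ₗ[k]
    LinearMap.ker (Module.Dual.transpose (R := k) (Qaux P) + LinearMap.id) where
  toFun b := ⟨b.1 1, by
    obtain ⟨b, h1, h2⟩ := b
    rw [LinearMap.mem_ker, LinearMap.add_apply, add_eq_zero_iff_eq_neg]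
    ext w
    have h := h2 1 w
    have h' := inv_apply_aux P b h1 w P.g
    simp at h
    exact h'.trans h⟩
  map_add' _ _ := rfl
  map_smul' _ _ := rfl
  invFun φ := ⟨formAux P φ.1, formAux_inv P φ.1, fun v w => by
    obtain ⟨φ, h⟩ := φ
    rw [LinearMap.mem_ker, LinearMap.add_apply, add_eq_zero_iff_eq_neg] at h
    have h' : φ (Qaux P (P.S v * w)) = -φ (P.S v * w) := LinearMap.congr_fun h _
    rw [Qaux_mul] at h'
    exact h'⟩
  left_inv b := by
    apply Subtype.ext
    ext v w
    exact inv_apply_aux P b.1 b.2.1 v w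
  right_inv φ := by
    apply Subtype.ext
    ext w
    simp [formAux_apply, P.S_one]

/-- For a finite-dimensional pivotal algebra (A, S, g) over a field of characteristic not
2, the FS indicator of the left regular representation equals the trace of the linear map
Q : A → A, Q(a) = S(a)·g. -/
theorem fsIndicator_regular
    (hchar : (2 : k) ≠ 0) [FiniteDimensional k A]
    (P : PivotalAlgebra k A) :
    (fsIndicator P (Algebra.lmul k A) : k) =
      LinearMap.trace k A ((LinearMap.mulRight k (↑P.g : A)) ∘ₗ P.S) := by
  change _ = LinearMap.trace k A (Qaux P)
  rw [← LinearMap.trace_transpose' (R := k) (M := A) (Qaux P),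
    trace_involution_aux hchar _ (fun φ => by
      ext a
      exact congrArg φ (Qaux_Qaux P a)),
    ← (plusEquiv P).finrank_eq, ← (minusEquiv P).finrank_eq]
  simp [fsIndicator]
end

section
/- Let (A, S, g) be a pivotal algebra over a field k of characteristic not 2 and let V be a finite-dimensional absolutely simple left A-module (so the action map ρ_V : A → End_k(V) is surjective) which is self-dual (V ≅ V^∨ as A-modules). Then the map S_V : End_k(V) → End_k(V) determined by S_V(ρ_V(a)) = ρ_V(S(a)) for all a ∈ A is well-defined, and Trace(S_V) = ν(V) · χ_V(g). -/
variable {k A : Type*} [Field k] [Ring A] [Algebra k A]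
variable {V : Type*} [AddCommGroup V] [Module k V]

theorem aux_trace_swap [FiniteDimensional k V] (G : Module.End k V)
    (T : TensorProduct k V V →ₗ[k] TensorProduct k V V) (c : k)
    (hT : ∀ x y : V, T (TensorProduct.tmul k y x) = c • TensorProduct.tmul k (G x) y) :
    LinearMap.trace k _ T = c * LinearMap.trace k V G := by
  classical
  let e := Module.finBasis k V
  rw [LinearMap.trace_eq_matrix_trace k (e.tensorProduct e), LinearMap.trace_eq_matrix_trace k e,
    Matrix.trace, Matrix.trace, Fintype.sum_prod_type, Finset.mul_sum]
  refine Finset.sum_congr rfl fun i _ => ?_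
  simp only [Matrix.diag_apply, LinearMap.toMatrix_apply, Module.Basis.tensorProduct_apply, hT,
    map_smul, Finsupp.smul_apply, Module.Basis.tensorProduct_repr_tmul_apply,
    Module.Basis.repr_self, smul_eq_mul]
  rw [Finset.sum_eq_single i]
  · simp
  · intro j _ hj
    simp [hj.symm]
  · simp

/-- For a finite-dimensional absolutely simple self-dual module V over a pivotal algebra
(A, S, g), the map S_V : End_k(V) → End_k(V) determined by S_V(ρ(a)) = ρ(S(a)) is
well-defined, and Trace(S_V) = ν(V)·χ_V(g). -/
theorem trace_SV
    (hchar : (2 : k) ≠ 0)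
    [FiniteDimensional k V] [Nontrivial V]
    (P : PivotalAlgebra k A) (ρ : A →ₐ[k] Module.End k V)
    (hsimple : ∀ W : Submodule k V, (∀ (a : A), ∀ v ∈ W, ρ a v ∈ W) → W = ⊥ ∨ W = ⊤)
    (habs : ∀ f : Module.End k V,
      (∀ a : A, f ∘ₗ ρ a = ρ a ∘ₗ f) → ∃ c : k, f = c • LinearMap.id)
    (hsurj : Function.Surjective ρ)
    (hselfdual : ∃ φ : V ≃ₗ[k] Module.Dual k V,
      ∀ (a : A) (v : V), φ (ρ a v) = (φ v) ∘ₗ ρ (P.S a)) :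
    ∃ SV : Module.End k V →ₗ[k] Module.End k V,
      (∀ a : A, SV (ρ a) = ρ (P.S a)) ∧
        LinearMap.trace k (Module.End k V) SV =
          (fsIndicator P ρ : k) * LinearMap.trace k V (ρ ↑P.g) := by
  obtain ⟨φ, hφ⟩ := hselfdual
  have hinv : ∀ (a : A) (v w : V), φ (ρ a v) w = φ v (ρ (P.S a) w) := fun a v w => by
    rw [hφ]; rfl
  -- every invariant form is a multiple of `φ`
  have huniq : ∀ b : V →ₗ[k] V →ₗ[k] k, IsInvariantBil P ρ b →
      ∃ c : k, ∀ v w, b v w = c * φ v w := by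
    intro b hb
    obtain ⟨c, hc⟩ := habs (φ.symm.toLinearMap ∘ₗ b) (by
      intro a
      ext v
      apply φ.injective
      ext w
      simp only [LinearMap.comp_apply, LinearEquiv.coe_coe, LinearEquiv.apply_symm_apply]
      rw [hinv, LinearEquiv.apply_symm_apply, hb])
    refine ⟨c, fun v w => ?_⟩
    have h1 : φ.symm (b v) = c • v := LinearMap.congr_fun hc v
    have h2 : b v = c • φ v := by
      rw [← map_smul, ← h1, LinearEquiv.apply_symm_apply]
    rw [h2]; rfl
  obtain ⟨c, hc⟩ := huniq ((φ.toLinearMap.flip) ∘ₗ ρ (P.g : A)) (by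
    intro a v w
    simp only [LinearMap.comp_apply, LinearMap.flip_apply, LinearEquiv.coe_coe]
    rw [hinv, P.S_S, ← Module.End.mul_apply, ← Module.End.mul_apply, ← map_mul, ← map_mul]
    simp)
  have hc' : ∀ v w, φ w (ρ (P.g : A) v) = c * φ v w := hc
  have hgg : ∀ v w, φ (ρ (P.g : A) v) (ρ (P.g : A) w) = φ v w := by
    intro v w
    rw [hinv, P.S_g, ← Module.End.mul_apply, ← map_mul]
    simp
  have hφ0 : ∃ v w, φ v w ≠ 0 := by
    by_contra! h
    obtain ⟨v, hv⟩ := exists_ne (0 : V)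
    apply hv
    apply φ.injective
    ext w
    simp [h v w]
  obtain ⟨v0, w0, h0⟩ := hφ0
  have hc2 : c * c = 1 := by
    have h1 := hgg v0 w0
    rw [hc', hc', ← mul_assoc] at h1
    exact mul_right_cancel₀ h0 (by rw [h1, one_mul])
  -- indicator
  have hnu : (fsIndicator P ρ : k) = c := by
    have key : ∀ b : V →ₗ[k] V →ₗ[k] k, IsInvariantBil P ρ b →
        ∃ t : k, b = t • φ.toLinearMap := by
      intro b hb
      obtain ⟨t, ht⟩ := huniq b hb
      exact ⟨t, by ext v w; simp [ht]⟩
    have hne : φ.toLinearMap ≠ 0 := fun h => h0 (by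
      have := LinearMap.congr_fun (LinearMap.congr_fun h v0) w0
      simpa using this)
    have hfr : Module.finrank k
        (Submodule.span k {(φ.toLinearMap : V →ₗ[k] V →ₗ[k] k)}) = 1 :=
      finrank_span_singleton (K := k) (V := V →ₗ[k] V →ₗ[k] k) hne
    have hinv' : IsInvariantBil P ρ φ.toLinearMap := fun a v w => hinv a v w
    rcases mul_self_eq_one_iff.mp hc2 with h | h
    · have h1 : BilPlus P ρ = Submodule.span k {φ.toLinearMap} := by
        apply le_antisymm
        · intro b hb
          obtain ⟨t, rfl⟩ := key b hb.1
          exact Submodule.smul_mem _ _ (Submodule.mem_span_singleton_self _)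
        · rw [Submodule.span_singleton_le_iff_mem]
          exact ⟨hinv', fun v w => by simp [hc', h]⟩
      have h2 : BilMinus P ρ = ⊥ := by
        rw [eq_bot_iff]
        intro b hb
        obtain ⟨t, rfl⟩ := key b hb.1
        have h3 := hb.2 v0 w0
        simp only [LinearMap.smul_apply, LinearEquiv.coe_coe, hc', h, smul_eq_mul, one_mul] at h3
        have h4 : 2 * (t * φ v0 w0) = 0 := by linear_combination h3
        have : t = 0 := by simpa [hchar, h0] using h4
        simp [this]
      rw [fsIndicator, h1, h2, hfr]
      simp [h]
    · have h1 : BilMinus P ρ = Submodule.span k {φ.toLinearMap} := by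
        apply le_antisymm
        · intro b hb
          obtain ⟨t, rfl⟩ := key b hb.1
          exact Submodule.smul_mem _ _ (Submodule.mem_span_singleton_self _)
        · rw [Submodule.span_singleton_le_iff_mem]
          exact ⟨hinv', fun v w => by simp [hc', h]⟩
      have h2 : BilPlus P ρ = ⊥ := by
        rw [eq_bot_iff]
        intro b hb
        obtain ⟨t, rfl⟩ := key b hb.1
        have h3 := hb.2 v0 w0
        simp only [LinearMap.smul_apply, LinearEquiv.coe_coe, hc', h, smul_eq_mul] at h3
        have h4 : 2 * (t * φ v0 w0) = 0 := by linear_combination -h3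
        have : t = 0 := by simpa [hchar, h0] using h4
        simp [this]
      rw [fsIndicator, h1, h2, hfr]
      simp [h]
  let ψ : V ≃ₗ[k] Module.Dual k V := (Module.evalEquiv k V).trans φ.dualMap
  have hψ : ∀ w v, ψ w v = φ v w := fun w v => rfl
  let SV : Module.End k V →ₗ[k] Module.End k V :=
    { toFun := fun f => ψ.symm.toLinearMap ∘ₗ f.dualMap ∘ₗ ψ.toLinearMap
      map_add' := fun f f' => by
        ext w
        apply ψ.injective
        ext v
        simp
      map_smul' := fun t f => by
        ext w
        apply ψ.injective
        ext v
        simp }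
  have hSV : ∀ f w v, φ v (SV f w) = φ (f v) w := by
    intro f w v
    rw [← hψ, ← hψ]
    change ψ (ψ.symm (f.dualMap (ψ w))) v = _
    rw [LinearEquiv.apply_symm_apply]
    rfl
  refine ⟨SV, ?_, ?_⟩
  · intro a
    ext w
    apply ψ.injective
    ext v
    rw [hψ, hψ, hSV, hinv]
  · let e : TensorProduct k V V ≃ₗ[k] Module.End k V :=
      (TensorProduct.congr ψ (LinearEquiv.refl k V)).trans (dualTensorHomEquiv k V V)
    have he : ∀ y x z, e (TensorProduct.tmul k y x) z = φ z y • x := fun y x z => by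
      simp [e, hψ]
    rw [hnu, ← LinearMap.trace_conj' SV e.symm]
    apply aux_trace_swap
    intro x y
    rw [LinearEquiv.conj_apply_apply]
    apply e.injective
    ext w
    apply ψ.injective
    ext v
    rw [LinearEquiv.apply_symm_apply, LinearEquiv.symm_symm, hψ, hψ, hSV, map_smul,
      LinearMap.smul_apply, he, he, hc', smul_smul, ← mul_assoc, hc2]
    simp [mul_comm]
end

section
/- Let (A, S, g) be a pivotal algebra over a field k of characteristic not 2 and let V be a finite-dimensional absolutely simple left A-module (so the action map ρ_V : A → End_k(V) is surjective) which is self-dual (V ≅ V^∨ as A-modules). Let S_V : End_k(V) → End_k(V) be the map determined by S_V(ρ_V(a)) = ρ_V(S(a)), and define Q_V : End_k(V) → End_k(V) by Q_V(f) = S_V(f) ∘ ρ_V(g). Then Trace(Q_V) = ν(V) · dim_k(V). -/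
variable {k A : Type*} [Field k] [Ring A] [Algebra k A]
variable {V : Type*} [AddCommGroup V] [Module k V]

open scoped TensorProduct

theorem trace_swap_aux [FiniteDimensional k V] :
    LinearMap.trace k (TensorProduct k V V) (TensorProduct.comm k V V).toLinearMap
      = (Module.finrank k V : k) := by
  classical
  let e := Module.finBasis k V
  rw [LinearMap.trace_eq_matrix_trace k (e.tensorProduct e)]
  simp only [Matrix.trace, Matrix.diag, LinearMap.toMatrix_apply, Fintype.sum_prod_type,
    Module.Basis.tensorProduct_apply, LinearEquiv.coe_coe, TensorProduct.comm_tmul,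
    Module.Basis.tensorProduct_repr_tmul_apply, Module.Basis.repr_self, Finsupp.single_apply]
  simp

/-- For a finite-dimensional absolutely simple self-dual module V over a pivotal algebra
(A, S, g), with S_V determined by S_V(ρ(a)) = ρ(S(a)) and Q_V(f) = S_V(f) ∘ ρ(g), one has
Trace(Q_V) = ν(V)·dim_k(V). -/
theorem trace_QV
    (hchar : (2 : k) ≠ 0)
    [FiniteDimensional k V] [Nontrivial V]
    (P : PivotalAlgebra k A) (ρ : A →ₐ[k] Module.End k V)
    (hsimple : ∀ W : Submodule k V, (∀ (a : A), ∀ v ∈ W, ρ a v ∈ W) → W = ⊥ ∨ W = ⊤)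
    (habs : ∀ f : Module.End k V,
      (∀ a : A, f ∘ₗ ρ a = ρ a ∘ₗ f) → ∃ c : k, f = c • LinearMap.id)
    (hsurj : Function.Surjective ρ)
    (hselfdual : ∃ φ : V ≃ₗ[k] Module.Dual k V,
      ∀ (a : A) (v : V), φ (ρ a v) = (φ v) ∘ₗ ρ (P.S a)) :
    ∃ SV QV : Module.End k V →ₗ[k] Module.End k V,
      (∀ a : A, SV (ρ a) = ρ (P.S a)) ∧
        (∀ f : Module.End k V, QV f = SV f ∘ₗ ρ ↑P.g) ∧
          LinearMap.trace k (Module.End k V) QV =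
            (fsIndicator P ρ : k) * (Module.finrank k V : k) := by
  obtain ⟨φ, hφ⟩ := hselfdual
  have hφ' : ∀ (a : A) (v w : V), φ (ρ a v) w = φ v (ρ (P.S a) w) := fun a v w => by
    rw [hφ]; rfl
  have hβinv : IsInvariantBil P ρ φ.toLinearMap := hφ'
  -- uniqueness of invariant forms
  have huniq : ∀ b : V →ₗ[k] V →ₗ[k] k, IsInvariantBil P ρ b →
      ∃ c : k, b = c • φ.toLinearMap := by
    intro b hb
    obtain ⟨c, hc⟩ := habs (φ.symm.toLinearMap ∘ₗ b) (by
      intro a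
      ext v
      apply φ.injective
      ext w
      simp [hφ', hb a v w])
    refine ⟨c, ?_⟩
    ext v w
    have h1 : φ.symm (b v) = c • v := by
      have := LinearMap.congr_fun hc v
      simpa using this
    have h2 : b v = c • φ v := by
      rw [← map_smul, ← h1, LinearEquiv.apply_symm_apply]
    simp [h2]
  obtain ⟨v0, hv0⟩ := exists_ne (0 : V)
  have hex : ∃ w0, φ v0 w0 ≠ 0 := by
    by_contra! h
    apply hv0
    apply φ.injective
    ext w
    simp [h w]
  obtain ⟨w0, hw0⟩ := hex
  have hgg : ∀ v : V, ρ (↑P.g⁻¹ : A) (ρ (↑P.g : A) v) = v := by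
    intro v
    rw [← Module.End.mul_apply, ← map_mul]; simp
  have hgg' : ∀ v : V, ρ (↑P.g : A) (ρ (↑P.g⁻¹ : A) v) = v := by
    intro v
    rw [← Module.End.mul_apply, ← map_mul]; simp
  obtain ⟨c, hc⟩ := huniq (φ.toLinearMap.flip.comp (ρ (↑P.g : A))) (by
    intro a v w
    simp only [LinearMap.comp_apply, LinearMap.flip_apply, LinearEquiv.coe_coe]
    rw [hφ', P.S_S]
    simp [hgg])
  have hc' : ∀ v w : V, φ w (ρ (↑P.g : A) v) = c * φ v w := by
    intro v w
    have := LinearMap.congr_fun (LinearMap.congr_fun hc v) w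
    simpa using this
  have hcc : c * c = 1 := by
    have h1 := hc' w0 (ρ (↑P.g : A) v0)
    rw [hc' v0 w0, hφ', P.S_g, hgg] at h1
    have h2 : (c * c - 1) * φ v0 w0 = 0 := by linear_combination -h1
    rcases mul_eq_zero.mp h2 with h | h
    · linear_combination h
    · exact absurd h hw0
  have hne : φ.toLinearMap ≠ 0 := by
    intro h
    apply hw0
    have := LinearMap.congr_fun (LinearMap.congr_fun h v0) w0
    simpa using this
  have hfr : Module.finrank k (Submodule.span k {(φ.toLinearMap : V →ₗ[k] V →ₗ[k] k)}) = 1 :=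
    finrank_span_singleton (K := k) (V := V →ₗ[k] V →ₗ[k] k) (v := φ.toLinearMap) hne
  have hP : ∀ d : k, (∀ v w : V, (d • φ.toLinearMap) w (ρ (↑P.g : A) v)
      = (d • φ.toLinearMap) v w) → d * (c - 1) = 0 := by
    intro d h
    have := h v0 w0
    simp [hc'] at this
    have h2 : (d * (c - 1)) * φ v0 w0 = 0 := by
      rcases this with h | h
      · linear_combination d * h
      · simp [h]
    exact (mul_eq_zero.mp h2).resolve_right hw0
  have hM : ∀ d : k, (∀ v w : V, (d • φ.toLinearMap) w (ρ (↑P.g : A) v)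
      = - (d • φ.toLinearMap) v w) → d * (c + 1) = 0 := by
    intro d h
    have := h v0 w0
    simp only [LinearMap.smul_apply, LinearEquiv.coe_coe, smul_eq_mul, hc'] at this
    have h2 : (d * (c + 1)) * φ v0 w0 = 0 := by linear_combination this
    exact (mul_eq_zero.mp h2).resolve_right hw0
  have hν : (fsIndicator P ρ : k) = c := by
    have hcases : c = 1 ∨ c = -1 := mul_self_eq_one_iff.mp hcc
    unfold fsIndicator
    rcases hcases with rfl | rfl
    · have h1 : BilPlus P ρ = Submodule.span k {φ.toLinearMap} := by
        apply le_antisymm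
        · rintro b ⟨hb, -⟩
          obtain ⟨d, rfl⟩ := huniq b hb
          exact Submodule.smul_mem _ _ (Submodule.mem_span_singleton_self _)
        · rw [Submodule.span_singleton_le_iff_mem]
          exact ⟨hβinv, fun v w => by simp [hc']⟩
      have h2 : BilMinus P ρ = ⊥ := by
        rw [eq_bot_iff]
        rintro b ⟨hb, hb'⟩
        obtain ⟨d, rfl⟩ := huniq b hb
        have h3 := hM d hb'
        have : d = 0 := by
          apply (mul_eq_zero.mp h3).resolve_right
          rw [one_add_one_eq_two]; exact hchar
        simp [this]
      rw [h1, h2, hfr]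
      simp
    · have h1 : BilMinus P ρ = Submodule.span k {φ.toLinearMap} := by
        apply le_antisymm
        · rintro b ⟨hb, -⟩
          obtain ⟨d, rfl⟩ := huniq b hb
          exact Submodule.smul_mem _ _ (Submodule.mem_span_singleton_self _)
        · rw [Submodule.span_singleton_le_iff_mem]
          exact ⟨hβinv, fun v w => by simp [hc']⟩
      have h2 : BilPlus P ρ = ⊥ := by
        rw [eq_bot_iff]
        rintro b ⟨hb, hb'⟩
        obtain ⟨d, rfl⟩ := huniq b hb
        have h3 := hP d hb'
        have : d = 0 := by
          apply (mul_eq_zero.mp h3).resolve_right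
          intro h
          apply hchar
          linear_combination -h
        simp [this]
      rw [h1, h2, hfr]
      simp
  -- right nondegeneracy
  let γ : V ≃ₗ[k] V := LinearEquiv.ofLinearMap (ρ (↑P.g : A)) (ρ (↑P.g⁻¹ : A))
    (LinearMap.ext hgg') (LinearMap.ext hgg)
  have hψinj : Function.Injective φ.toLinearMap.flip := by
    rw [← LinearMap.ker_eq_bot, LinearMap.ker_eq_bot']
    intro w hw
    have h1 : φ (γ.symm w) = 0 := by
      ext x
      have h2 := LinearMap.congr_fun hw x
      have h3 := hc' (γ.symm w) x
      have h4 : ρ (↑P.g : A) (γ.symm w) = w := hgg' w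
      rw [h4] at h3
      have h5 : φ x w = 0 := by simpa using h2
      rw [h5] at h3
      simp only [LinearMap.zero_apply]
      linear_combination (-φ (γ.symm w) x) * hcc - c * h3
    simpa using h1
  let ψ : V ≃ₗ[k] Module.Dual k V := LinearEquiv.ofInjectiveOfFinrankEq
    φ.toLinearMap.flip hψinj (Subspace.dual_finrank_eq).symm
  have hψ : ∀ v w : V, ψ w v = φ v w := fun v w => rfl
  let SV : Module.End k V →ₗ[k] Module.End k V :=
    { toFun := fun f => ψ.symm.toLinearMap ∘ₗ f.dualMap ∘ₗ ψ.toLinearMap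
      map_add' := by
        intro f f'
        ext w
        apply ψ.injective
        ext x
        simp
      map_smul' := by
        intro d f
        ext w
        apply ψ.injective
        ext x
        simp }
  have hSV : ∀ (f : Module.End k V) (v w : V), φ v (SV f w) = φ (f v) w := by
    intro f v w
    rw [← hψ, ← hψ]
    simp [SV]
  have hSVu : ∀ (f f' : Module.End k V), (∀ v w, φ v (f' w) = φ (f v) w) → SV f = f' := by
    intro f f' h
    ext w
    apply ψ.injective
    ext v
    rw [hψ, hψ, hSV, h]
  let QV : Module.End k V →ₗ[k] Module.End k V :=
    (LinearMap.mulRight k (ρ (↑P.g : A))) ∘ₗ SV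
  have hQV : ∀ f : Module.End k V, QV f = SV f ∘ₗ ρ ↑P.g := fun f => rfl
  refine ⟨SV, QV, fun a => hSVu _ _ fun v w => (hφ' a v w).symm, hQV, ?_⟩
  let E : TensorProduct k V V ≃ₗ[k] Module.End k V :=
    (TensorProduct.congr φ γ).trans (dualTensorHomEquiv k V V)
  have hE : ∀ u v x : V, E (u ⊗ₜ[k] v) x = φ u x • ρ (↑P.g : A) v := by
    intro u v x
    simp [E, γ]
  have key : QV = E.conj (c • (TensorProduct.comm k V V).toLinearMap) := by
    have h : QV ∘ₗ E.toLinearMap = E.toLinearMap ∘ₗ (c • (TensorProduct.comm k V V).toLinearMap) := by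
      apply TensorProduct.ext'
      intro u v
      have h1 : SV (E (u ⊗ₜ[k] v)) = (c • ((φ (ρ (↑P.g : A) v)).smulRight (ρ (↑P.g : A) u))) := by
        apply hSVu
        intro x w
        simp only [hE, LinearMap.smul_apply, LinearMap.smulRight_apply, map_smul, smul_eq_mul, hc']
        linear_combination (φ u x * φ (ρ (↑P.g : A) v) w) * hcc
      simp only [LinearMap.comp_apply, LinearEquiv.coe_coe, hQV, h1, LinearMap.smul_apply,
        TensorProduct.comm_tmul, map_smul]
      ext x
      simp only [LinearMap.comp_apply, LinearMap.smul_apply, LinearMap.smulRight_apply, hE]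
      rw [hφ', P.S_g, hgg]
    ext f : 1
    have h2 := LinearMap.congr_fun h (E.symm f)
    simpa [LinearEquiv.conj_apply] using h2
  rw [key, LinearMap.trace_conj', map_smul, trace_swap_aux, hν, smul_eq_mul]
end

section
/- Let (A, S, g) be a pivotal algebra over a field k of characteristic not 2, and suppose A is separable with separability idempotent E = Σ_i E'_i ⊗ E''_i ∈ A ⊗ A (so Σ_i E'_i E''_i = 1 and Σ_i a E'_i ⊗ E''_i = Σ_i E'_i ⊗ E''_i a for all a ∈ A). Then for every finite-dimensional left A-module V with character χ_V, one has ν(V) = Σ_i χ_V( S(E'_i) g E''_i ). -/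
variable {k A : Type*} [Field k] [Ring A] [Algebra k A]
variable {V : Type*} [AddCommGroup V] [Module k V]

open TensorProduct


/-- The operator `b ↦ ((v, w) ↦ b (X v) (Y w))` . -/
def fsOp (X Y : Module.End k V) : Module.End k (V →ₗ[k] V →ₗ[k] k) where
  toFun b := b.compl₁₂ X Y
  map_add' b c := by ext; simp
  map_smul' r b := by ext; simp

/-- The averaging operator. -/
noncomputable def fsPi (P : PivotalAlgebra k A) (ρ : A →ₐ[k] Module.End k V) :
    A ⊗[k] A →ₗ[k] Module.End k (V →ₗ[k] V →ₗ[k] k) :=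
  TensorProduct.lift (LinearMap.mk₂ k (fun x y => fsOp (ρ y) (ρ (P.S x)))
    (fun x x' y => by ext; simp [fsOp])
    (fun r x y => by ext; simp [fsOp])
    (fun x y y' => by ext; simp [fsOp])
    (fun r x y => by ext; simp [fsOp]))

theorem fsPi_tmul (P : PivotalAlgebra k A) (ρ : A →ₐ[k] Module.End k V) (x y : A)
    (b : V →ₗ[k] V →ₗ[k] k) (v w : V) :
    fsPi P ρ (x ⊗ₜ y) b v w = b (ρ y v) (ρ (P.S x) w) := by
  simp [fsPi, fsOp]

/-- The operator `Σ`. -/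
def fsSigma (P : PivotalAlgebra k A) (ρ : A →ₐ[k] Module.End k V) :
    Module.End k (V →ₗ[k] V →ₗ[k] k) where
  toFun b := (b.compl₁₂ LinearMap.id (ρ P.g)).flip
  map_add' b c := by ext; simp
  map_smul' r b := by ext; simp

theorem fsSigma_apply (P : PivotalAlgebra k A) (ρ : A →ₐ[k] Module.End k V)
    (b : V →ₗ[k] V →ₗ[k] k) (v w : V) : fsSigma P ρ b v w = b w (ρ P.g v) := rfl

theorem fsPi_right (P : PivotalAlgebra k A) (ρ : A →ₐ[k] Module.End k V) (E : A ⊗[k] A) (a : A)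
    (b : V →ₗ[k] V →ₗ[k] k) (v w : V) :
    fsPi P ρ (TensorProduct.map LinearMap.id (LinearMap.mulRight k a) E) b v w
      = fsPi P ρ E b (ρ a v) w := by
  induction E with
  | zero => simp
  | tmul x y => simp [fsPi_tmul]
  | add x y hx hy => simp [hx, hy]

theorem fsPi_left (P : PivotalAlgebra k A) (ρ : A →ₐ[k] Module.End k V) (E : A ⊗[k] A) (a : A)
    (b : V →ₗ[k] V →ₗ[k] k) (v w : V) :
    fsPi P ρ (TensorProduct.map (LinearMap.mulLeft k a) LinearMap.id E) b v w
      = fsPi P ρ E b v (ρ (P.S a) w) := by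
  induction E with
  | zero => simp
  | tmul x y => simp [fsPi_tmul, P.S_mul]
  | add x y hx hy => simp [hx, hy]

theorem fsPi_inv (P : PivotalAlgebra k A) (ρ : A →ₐ[k] Module.End k V) (E : A ⊗[k] A)
    (b : V →ₗ[k] V →ₗ[k] k) (hb : IsInvariantBil P ρ b) (v w : V) :
    fsPi P ρ E b v w = b (ρ (LinearMap.mul' k A E) v) w := by
  induction E with
  | zero => simp
  | tmul x y => simp [fsPi_tmul, hb x]
  | add x y hx hy => simp [hx, hy]

theorem fsSigma_inv (P : PivotalAlgebra k A) (ρ : A →ₐ[k] Module.End k V)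
    (b : V →ₗ[k] V →ₗ[k] k) (hb : IsInvariantBil P ρ b) : IsInvariantBil P ρ (fsSigma P ρ b) := by
  intro a v w
  rw [fsSigma_apply, fsSigma_apply, hb, P.S_S, ← Module.End.mul_apply, ← Module.End.mul_apply,
    ← map_mul, ← map_mul]
  simp [mul_assoc]

theorem fsSigma_sq (P : PivotalAlgebra k A) (ρ : A →ₐ[k] Module.End k V)
    (b : V →ₗ[k] V →ₗ[k] k) (hb : IsInvariantBil P ρ b) : fsSigma P ρ (fsSigma P ρ b) = b := by
  ext v w
  rw [fsSigma_apply, fsSigma_apply, hb, P.S_g, ← Module.End.mul_apply, ← map_mul]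
  simp

theorem fs_gen {W : Type*} [AddCommGroup W] [Module k W] [FiniteDimensional k W]
    (hchar : (2 : k) ≠ 0) (T : Module.End k W) (p m : Submodule k W)
    (hT3 : ∀ b, T (T (T b)) = T b) (hp : ∀ b, b ∈ p ↔ T b = b) (hm : ∀ b, b ∈ m ↔ T b + b = 0) :
    (Module.finrank k p : k) - (Module.finrank k m : k) = LinearMap.trace k W T := by
  replace hm : ∀ b, b ∈ m ↔ T b = -b := fun b => by rw [hm, add_eq_zero_iff_eq_neg]
  have h1 : LinearMap.IsProj p ((2⁻¹ : k) • (T * T + T)) := by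
    constructor
    · intro b
      refine (hp _).2 ?_
      simp [hT3, add_comm]
    · intro b hb
      replace hb := (hp _).1 hb
      simp only [LinearMap.smul_apply, LinearMap.add_apply, Module.End.mul_apply, hb]
      rw [← two_smul k b, smul_smul, inv_mul_cancel₀ hchar, one_smul]
  have h2 : LinearMap.IsProj m ((2⁻¹ : k) • (T * T - T)) := by
    constructor
    · intro b
      refine (hm _).2 ?_
      simp only [LinearMap.smul_apply, LinearMap.sub_apply, Module.End.mul_apply, map_smul,
        map_sub, hT3]
      rw [← smul_neg, neg_sub]
    · intro b hb
      replace hb := (hm _).1 hb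
      simp only [LinearMap.smul_apply, LinearMap.sub_apply, Module.End.mul_apply, hb, map_neg,
        neg_neg, sub_neg_eq_add]
      rw [← two_smul k b, smul_smul, inv_mul_cancel₀ hchar, one_smul]
  rw [← h1.trace, ← h2.trace]
  simp only [map_smul, map_add, map_sub, smul_eq_mul]
  field_simp
  ring

theorem fs_trace_op [FiniteDimensional k V] (P : PivotalAlgebra k A) (ρ : A →ₐ[k] Module.End k V)
    (x y : A) :
    LinearMap.trace k _ (fsSigma P ρ * fsPi P ρ (x ⊗ₜ y)) =
      LinearMap.trace k V (ρ (P.S x * P.g * y)) := by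
  classical
  let e := Module.finBasis k V
  let B := (Matrix.stdBasis k (Fin (Module.finrank k V)) (Fin (Module.finrank k V))).map
    (LinearMap.toMatrix₂ e e : (V →ₗ[k] V →ₗ[k] k) ≃ₗ[k] _).symm
  have key : ∀ X Y : Module.End k V, LinearMap.trace k V (X * Y) =
      ∑ i, ∑ j, e.repr (X (e j)) i * e.repr (Y (e i)) j := by
    intro X Y
    rw [LinearMap.trace_eq_matrix_trace k e, LinearMap.toMatrix_mul]
    simp [Matrix.trace, Matrix.mul_apply, LinearMap.toMatrix_apply]
  have h : LinearMap.trace k V (ρ (P.S x * P.g * y)) =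
      LinearMap.trace k V (ρ y * ρ (P.S x * P.g)) := by
    rw [map_mul ρ, LinearMap.trace_mul_comm]
  rw [h, key, LinearMap.trace_eq_matrix_trace k B, Matrix.trace, Fintype.sum_prod_type]
  refine Finset.sum_congr rfl fun i _ => Finset.sum_congr rfl fun j _ => ?_
  have hr : ∀ b : V →ₗ[k] V →ₗ[k] k, B.repr b (i, j) = b (e i) (e j) := by
    intro b
    simp [B, Matrix.stdBasis, LinearMap.toMatrix₂_apply]
  have hB : ∀ v w, B (i, j) v w = e.repr v i * e.repr w j := by
    intro v w
    simp [B, Matrix.stdBasis_eq_single, Matrix.toLinearMap₂_apply, Matrix.single_apply, ite_and]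
  rw [Matrix.diag_apply, LinearMap.toMatrix_apply, hr, Module.End.mul_apply, fsSigma_apply,
    fsPi_tmul, hB]
  simp

theorem fs_mem_plus (P : PivotalAlgebra k A) (ρ : A →ₐ[k] Module.End k V)
    (b : V →ₗ[k] V →ₗ[k] k) :
    b ∈ BilPlus P ρ ↔ IsInvariantBil P ρ b ∧ fsSigma P ρ b = b := by
  refine and_congr_right fun hb => ?_
  constructor
  · intro h
    ext v w
    exact h v w
  · intro h v w
    rw [← fsSigma_apply, h]

theorem fs_mem_minus (P : PivotalAlgebra k A) (ρ : A →ₐ[k] Module.End k V)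
    (b : V →ₗ[k] V →ₗ[k] k) :
    b ∈ BilMinus P ρ ↔ IsInvariantBil P ρ b ∧ fsSigma P ρ b = -b := by
  refine and_congr_right fun hb => ?_
  constructor
  · intro h
    ext v w
    rw [LinearMap.neg_apply, LinearMap.neg_apply]
    exact h v w
  · intro h v w
    rw [← fsSigma_apply, h, LinearMap.neg_apply, LinearMap.neg_apply]

theorem fs_trace_all [FiniteDimensional k V] (P : PivotalAlgebra k A)
    (ρ : A →ₐ[k] Module.End k V) (F : A ⊗[k] A) :
    LinearMap.trace k _ (fsSigma P ρ * fsPi P ρ F) =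
      (LinearMap.trace k V ∘ₗ ρ.toLinearMap)
        (LinearMap.mul' k A
          (TensorProduct.map ((LinearMap.mulRight k (↑P.g : A)) ∘ₗ P.S) LinearMap.id F)) := by
  induction F with
  | zero => simp
  | tmul x y => rw [fs_trace_op]; simp
  | add x y hx hy => rw [map_add, mul_add, map_add, hx, hy]; simp only [map_add]

theorem fs_inv_neg (P : PivotalAlgebra k A) (ρ : A →ₐ[k] Module.End k V)
    (b : V →ₗ[k] V →ₗ[k] k) (h : IsInvariantBil P ρ (-b)) : IsInvariantBil P ρ b := by
  intro a v w
  have := h a v w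
  rw [LinearMap.neg_apply, LinearMap.neg_apply, LinearMap.neg_apply, LinearMap.neg_apply] at this
  exact neg_injective this

theorem fs_main [FiniteDimensional k V] (hchar : (2 : k) ≠ 0) (P : PivotalAlgebra k A)
    (ρ : A →ₐ[k] Module.End k V) (T : Module.End k (V →ₗ[k] V →ₗ[k] k))
    (hTi : ∀ b, IsInvariantBil P ρ (T b))
    (hTs : ∀ b, IsInvariantBil P ρ b → T b = fsSigma P ρ b) :
    (fsIndicator P ρ : k) = LinearMap.trace k _ T := by
  have hT3 : ∀ b, T (T (T b)) = T b := by
    intro b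
    rw [hTs _ (hTi _), hTs _ (hTi _), fsSigma_sq P ρ _ (hTi _)]
  have hp : ∀ b, b ∈ BilPlus P ρ ↔ T b = b := by
    intro b
    rw [fs_mem_plus]
    constructor
    · rintro ⟨h1, h2⟩
      rw [hTs b h1, h2]
    · intro h
      have hi : IsInvariantBil P ρ b := by
        have := hTi b
        rwa [h] at this
      exact ⟨hi, by rw [← hTs b hi, h]⟩
  have hm : ∀ b, b ∈ BilMinus P ρ ↔ T b = -b := by
    intro b
    rw [fs_mem_minus]
    constructor
    · rintro ⟨h1, h2⟩
      rw [hTs b h1, h2]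
    · intro h
      have hi : IsInvariantBil P ρ b := by
        have := hTi b
        rw [h] at this
        exact fs_inv_neg P ρ b this
      exact ⟨hi, by rw [← hTs b hi, h]⟩
  have hm' : ∀ b, b ∈ BilMinus P ρ ↔ T b + b = 0 := fun b => by
    rw [hm]
    constructor
    · intro h
      rw [h]
      ext v w
      simp
    · intro h
      ext v w
      have := congrArg (fun c => c v w) h
      simpa [add_eq_zero_iff_eq_neg] using this
  have := fs_gen (W := V →ₗ[k] V →ₗ[k] k) hchar T (BilPlus P ρ) (BilMinus P ρ) hT3 hp hm'
  rw [fsIndicator, ← this, Int.cast_sub, Int.cast_natCast, Int.cast_natCast]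

/-- For a separable pivotal algebra (A, S, g) with separability idempotent
E = Σᵢ E'ᵢ ⊗ E''ᵢ, the FS indicator of any finite-dimensional left A-module V is
ν(V) = Σᵢ χ_V(S(E'ᵢ)·g·E''ᵢ). -/
theorem fsIndicator_of_separable
    (hchar : (2 : k) ≠ 0)
    (P : PivotalAlgebra k A)
    (E : A ⊗[k] A)
    (hE₁ : LinearMap.mul' k A E = 1)
    (hE₂ : ∀ a : A,
      TensorProduct.map (LinearMap.mulLeft k a) LinearMap.id E =
        TensorProduct.map LinearMap.id (LinearMap.mulRight k a) E)
    [FiniteDimensional k V] (ρ : A →ₐ[k] Module.End k V) :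
    (fsIndicator P ρ : k) =
      (LinearMap.trace k V ∘ₗ ρ.toLinearMap)
        (LinearMap.mul' k A
          (TensorProduct.map ((LinearMap.mulRight k (↑P.g : A)) ∘ₗ P.S) LinearMap.id E)) := by
  rw [← fs_trace_all]
  have hpi : ∀ b, IsInvariantBil P ρ (fsPi P ρ E b) := by
    intro b a v w
    rw [← fsPi_right, ← fsPi_left, hE₂]
  have hid : ∀ b, IsInvariantBil P ρ b → fsPi P ρ E b = b := by
    intro b hb
    ext v w
    rw [fsPi_inv P ρ E b hb, hE₁, map_one, Module.End.one_apply]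
  refine fs_main hchar P ρ _ (fun b => fsSigma_inv P ρ _ (hpi b)) (fun b hb => ?_)
  rw [Module.End.mul_apply, hid b hb]
end
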